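/- arXiv:math/0505138 — 2 statements merged into one kernel-verified Lean document; each statement's English description precedes it below -/
import Mathlib

section
/- Let F ⊆ P²(F₄) be a four-point subset consisting of four collinear points. Then the number of words c ∈ Pow(P²(F₄)) of weight 6 that are centers of Cremona transformation with respect to C_F is exactly 2224. -/
/-- An `F`-rational line in the projective plane over `F`: the vanishing set of a nonzero
linear functional. -/
def IsProjLine (F : Type*) [Field F] (L : Set (Projectivization F (Fin 3 → F))) : Prop :=
  ∃ φ : (Fin 3 → F) →ₗ[F] F, φ ≠ 0 ∧ L = {P | φ P.rep = 0}

/-- A set of points of the projective plane is collinear if it is contained in a line. -/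
def CollinSet (F : Type*) [Field F] (T : Set (Projectivization F (Fin 3 → F))) : Prop :=
  ∃ L, IsProjLine F L ∧ T ⊆ L

/-- The Dolgachev–Kondō code `C_DK ⊆ Pow(P²(F₄))`: the `F₂`-linear span of the (indicator
functions of the) point sets of the `F₄`-rational lines. -/
noncomputable def CDK (F : Type*) [Field F] :
    Submodule (ZMod 2) (Projectivization F (Fin 3 → F) → ZMod 2) :=
  Submodule.span (ZMod 2)
    {w | ∃ L : Set (Projectivization F (Fin 3 → F)), IsProjLine F L ∧
      w = Set.indicator L (fun _ => (1 : ZMod 2))}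

/-- The code `C_F = {w ∈ C_DK : |w ∩ F| even}`: the condition `|w ∩ F| ≡ 0 (mod 2)` is the
vanishing of the `F₂`-linear functional `w ↦ ∑_{x ∈ F} w(x)`. -/
noncomputable def CF (F : Type*) [Field F] (Fs : Finset (Projectivization F (Fin 3 → F))) :
    Submodule (ZMod 2) (Projectivization F (Fin 3 → F) → ZMod 2) :=
  CDK F ⊓ LinearMap.ker (∑ x ∈ Fs, LinearMap.proj x)

/-- The weight of a word `w ∈ Pow(S) = F₂^S`: the cardinality of its support. -/
noncomputable def wt {S : Type*} (w : S → ZMod 2) : ℕ := {x | w x = 1}.ncard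

/-- A linear word of a code: a word of the code of weight 5. -/
def IsLinearWord {S : Type*} (C : Submodule (ZMod 2) (S → ZMod 2)) (w : S → ZMod 2) : Prop :=
  w ∈ C ∧ wt w = 5

/-- A quadratic word of a code: a word of the code of weight 8 which is not the sum of two
linear words of the code. -/
def IsQuadraticWord {S : Type*} (C : Submodule (ZMod 2) (S → ZMod 2)) (w : S → ZMod 2) : Prop :=
  w ∈ C ∧ wt w = 8 ∧
    ¬ ∃ l₁ l₂ : S → ZMod 2, IsLinearWord C l₁ ∧ IsLinearWord C l₂ ∧ w = l₁ + l₂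

/-- A center of Cremona transformation with respect to a code `C`: a word of weight 6 which
meets every linear word of `C` in at most 2 points and every quadratic word of `C` in at
most 4 points. -/
def IsCremonaCenter {S : Type*} (C : Submodule (ZMod 2) (S → ZMod 2)) (c : S → ZMod 2) :
    Prop :=
  wt c = 6 ∧
    (∀ l, IsLinearWord C l → ({x | c x = 1} ∩ {x | l x = 1}).ncard ≤ 2) ∧
    (∀ q, IsQuadraticWord C q → ({x | c x = 1} ∩ {x | q x = 1}).ncard ≤ 4)

/-! ### Counting sublists under many upper bounds at once

Upper bounds on several counters are tested simultaneously by storing the counters as the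
hexadecimal digits of a single natural number. -/

/-- The natural number with hexadecimal digits `l`, least significant digit first. -/
def packDigits (l : List ℕ) : ℕ := l.foldr (fun d r => d + 16 * r) 0

theorem packDigits_map_add {β : Type*} (l : List β) (f g : β → ℕ) :
    packDigits (l.map f) + packDigits (l.map g) = packDigits (l.map fun b => f b + g b) := by
  induction l with
  | nil => rfl
  | cons b l ih =>
    simp only [packDigits, List.map_cons, List.foldr_cons] at ih ⊢
    omega

theorem land_digit_eq_zero_iff {d x m : ℕ} (hd : d < 16) :
    (d + 16 * x) &&& (8 + 16 * m) = 0 ↔ d < 8 ∧ x &&& m = 0 := by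
  have hdiv := Nat.and_div_two_pow (a := d + 16 * x) (b := 8 + 16 * m) (n := 4)
  have hmod := Nat.and_mod_two_pow (a := d + 16 * x) (b := 8 + 16 * m) (n := 4)
  have e1 : (d + 16 * x) / 2 ^ 4 = x := by omega
  have e2 : (8 + 16 * m) / 2 ^ 4 = m := by omega
  have e3 : (d + 16 * x) % 2 ^ 4 = d := by omega
  have e4 : (8 + 16 * m) % 2 ^ 4 = 8 := by omega
  rw [e1, e2] at hdiv
  rw [e3, e4] at hmod
  have hd8 : d &&& 8 = 0 ↔ d < 8 := by
    interval_cases d <;> decide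
  rw [← hd8, ← hdiv, ← hmod]
  omega

theorem packDigits_land_eq_zero_iff {β : Type*} (l : List β) (f : β → ℕ)
    (hf : ∀ b ∈ l, f b < 16) :
    packDigits (l.map f) &&& packDigits (l.map fun _ => 8) = 0 ↔ ∀ b ∈ l, f b < 8 := by
  induction l with
  | nil => simp [packDigits]
  | cons b l ih =>
    have ih := ih fun x hx => hf x (List.mem_cons_of_mem _ hx)
    simp only [packDigits, List.map_cons, List.foldr_cons] at ih ⊢
    rw [land_digit_eq_zero_iff (hf b List.mem_cons_self), ih, List.forall_mem_cons]

/-- The number of ways to add `k` entries of the list to the accumulator without ever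
meeting the mask. -/
def countPacked (mask : ℕ) : List ℕ → ℕ → ℕ → ℕ
  | _, 0, _ => 1
  | [], _ + 1, _ => 0
  | w :: ws, k + 1, a =>
    countPacked mask ws (k + 1) a +
      bif Nat.beq (Nat.land (a + w) mask) 0 then countPacked mask ws k (a + w) else 0

theorem countPacked_eq_countP {α β : Type*} (l : List β) (W : α → β → ℕ)
    (hW : ∀ p, ∀ b ∈ l, W p b ≤ 8) (ps : List α) (k : ℕ) (d : β → ℕ) (hd : ∀ b ∈ l, d b < 8) :
    countPacked (packDigits (l.map fun _ => 8)) (ps.map fun p => packDigits (l.map (W p))) k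
        (packDigits (l.map d)) =
      (ps.sublistsLen k).countP (fun s => ∀ b ∈ l, d b + (s.map (W · b)).sum < 8) := by
  induction ps generalizing k d with
  | nil =>
    cases k with
    | zero => simpa [countPacked] using hd
    | succ k => simp [countPacked]
  | cons p ps ih =>
    cases k with
    | zero => simpa [countPacked] using hd
    | succ k =>
      rw [List.map_cons, countPacked, List.sublistsLen_succ_cons, List.countP_append,
        List.countP_map, ih _ d hd, packDigits_map_add]
      congr 1
      have hland := packDigits_land_eq_zero_iff l (fun b => d b + W p b)
        fun b hb => by have := hd b hb; have := hW p b hb; omega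
      by_cases h : ∀ b ∈ l, d b + W p b < 8
      · have hz : Nat.beq (Nat.land (packDigits (l.map fun b => d b + W p b))
            (packDigits (l.map fun _ => 8))) 0 = true :=
          Nat.beq_eq ▸ hland.2 h
        rw [hz, cond_true, ih k _ h]
        simp only [Function.comp_def, List.map_cons, List.sum_cons, add_assoc]
      · have hz : Nat.beq (Nat.land (packDigits (l.map fun b => d b + W p b))
            (packDigits (l.map fun _ => 8))) 0 = false := by
          rw [Bool.eq_false_iff, ne_eq, Nat.beq_eq]
          exact fun h' => h (hland.1 h')
        rw [hz, cond_false, eq_comm, List.countP_eq_zero]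
        intro s _ hs
        refine h fun b hb => ?_
        have := of_decide_eq_true hs b hb
        simp only [List.map_cons, List.sum_cons] at this
        omega

theorem card_filter_powersetCard_univ (n k : ℕ) (P : Finset (Fin n) → Prop) [DecidablePred P]
    (Q : List (Fin n) → Prop) [DecidablePred Q]
    (h : ∀ s : Finset (Fin n), ∀ l : List (Fin n), s.val = l → (P s ↔ Q l)) :
    ((Finset.univ.powersetCard k).filter P).card
      = ((List.finRange n).sublistsLen k).countP (fun l => Q l) := by
  have hv : ((List.finRange n : List (Fin n)) : Multiset (Fin n)) = Finset.univ.val := rfl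
  have hmap : ((((List.finRange n).sublistsLen k).map Multiset.ofList : List (Multiset (Fin n))) :
      Multiset (Multiset (Fin n))) = (Finset.univ.powersetCard k).val.map Finset.val := by
    rw [Finset.map_val_val_powersetCard, ← hv, Multiset.powersetCard_coe]
  classical
  have hP : ((Finset.univ.powersetCard k).filter P).card =
      Multiset.countP (fun m => ∃ s : Finset (Fin n), s.val = m ∧ P s)
        ((Finset.univ.powersetCard k).val.map Finset.val) := by
    rw [Multiset.countP_map, Finset.card_def, Finset.filter_val]
    congr 1
    refine Multiset.filter_congr fun s _ => ?_
    simp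
  rw [hP, ← hmap, Multiset.coe_countP, List.countP_map]
  refine List.countP_congr fun l hl => ?_
  have hl' : (l : Multiset (Fin n)) ∈ (Finset.univ.powersetCard k).val.map Finset.val := by
    rw [← hmap]
    exact List.mem_map_of_mem hl
  obtain ⟨s, -, hs⟩ := Multiset.mem_map.1 hl'
  simp only [Function.comp_apply, decide_eq_true_eq]
  rw [← h s l hs]
  constructor
  · rintro ⟨t, ht, hPt⟩
    rwa [Finset.val_injective (hs.trans ht.symm)]
  · exact fun hPs => ⟨s, hs, hPs⟩

/-! ### Words as bit masks -/

/-- The word with support the binary digits of `m`. -/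
def maskWord (n m : ℕ) (i : Fin n) : ZMod 2 := if m.testBit i then 1 else 0

theorem maskWord_xor (n a b : ℕ) : maskWord n (a ^^^ b) = maskWord n a + maskWord n b := by
  funext i
  simp only [maskWord, Pi.add_apply, Nat.testBit_xor]
  cases a.testBit i <;> cases b.testBit i <;> decide

/-- The number of binary digits `1` of `m` among the first `n`. -/
def bitCount (n m : ℕ) : ℕ := (List.finRange n).countP fun i : Fin n => m.testBit i

theorem setOf_maskWord_eq_one (n m : ℕ) :
    {x | maskWord n m x = 1} = {x : Fin n | m.testBit x} := by
  ext x
  simp [maskWord]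

theorem wt_maskWord (n m : ℕ) : wt (maskWord n m) = bitCount n m := by
  rw [wt, setOf_maskWord_eq_one, bitCount, Set.ncard_eq_toFinset_card', Set.toFinset_ofPred,
    Finset.card_def, Finset.filter_val, ← Multiset.countP_eq_card_filter]
  change Multiset.countP _ ((List.finRange n : List (Fin n)) : Multiset (Fin n)) = _
  rw [Multiset.coe_countP]
  simp

/-- All sums (bitwise exclusive or) of sublists of a list of bit masks. -/
def xorSpan : List ℕ → List ℕ
  | [] => [0]
  | g :: gs => xorSpan gs ++ (xorSpan gs).map (g ^^^ ·)

theorem mem_span_maskWord_iff (n : ℕ) (gs : List ℕ) (w : Fin n → ZMod 2) :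
    w ∈ Submodule.span (ZMod 2) {v | ∃ g ∈ gs, v = maskWord n g} ↔
      ∃ m ∈ xorSpan gs, w = maskWord n m := by
  induction gs generalizing w with
  | nil =>
    have : maskWord n 0 = 0 := by funext i; simp [maskWord]
    simp [xorSpan, this]
  | cons g gs ih =>
    have hset : {v | ∃ h ∈ g :: gs, v = maskWord n h} =
        insert (maskWord n g) {v | ∃ h ∈ gs, v = maskWord n h} := by
      ext v
      simp
    rw [hset, Submodule.mem_span_insert]
    simp only [ih, xorSpan, List.mem_append, List.mem_map]
    constructor
    · rintro ⟨a, _, ⟨m, hm, rfl⟩, rfl⟩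
      obtain rfl | rfl : a = 0 ∨ a = 1 := by revert a; decide
      · exact ⟨m, Or.inl hm, by simp⟩
      · exact ⟨g ^^^ m, Or.inr ⟨m, hm, rfl⟩, by rw [maskWord_xor, one_smul]⟩
    · rintro ⟨_, hm | ⟨m, hm, rfl⟩, rfl⟩
      · exact ⟨0, _, ⟨_, hm, rfl⟩, by simp⟩
      · exact ⟨1, _, ⟨m, hm, rfl⟩, by rw [maskWord_xor, one_smul]⟩

/-! ### A concrete model of the projective plane of order four -/

/-- The field with four elements: `a` and `b` are the primitive third roots of unity. -/
inductive FourField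
  | zero | one | a | b
  deriving DecidableEq

namespace FourField

instance : Fintype FourField := ⟨{zero, one, a, b}, by intro x; cases x <;> decide⟩

instance : Zero FourField := ⟨zero⟩

instance : One FourField := ⟨one⟩

/-- Addition in the field with four elements. -/
protected def add : FourField → FourField → FourField
  | zero, y => y
  | x, zero => x
  | one, one => zero
  | one, a => b
  | one, b => a
  | a, one => b
  | a, a => zero
  | a, b => one
  | b, one => a
  | b, a => one
  | b, b => zero

/-- Multiplication in the field with four elements. -/
protected def mul : FourField → FourField → FourField
  | zero, _ => zero
  | _, zero => zero
  | one, y => y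
  | x, one => x
  | a, a => b
  | a, b => one
  | b, a => one
  | b, b => a

/-- Inversion in the field with four elements. -/
protected def inv : FourField → FourField
  | zero => zero
  | one => one
  | a => b
  | b => a

instance : Add FourField := ⟨FourField.add⟩

instance : Mul FourField := ⟨FourField.mul⟩

instance : Neg FourField := ⟨id⟩

instance : Inv FourField := ⟨FourField.inv⟩

instance : Field FourField where
  add_assoc := by decide
  zero_add := by decide
  add_zero := by decide
  add_comm := by decide
  neg_add_cancel := by decide
  left_distrib := by decide
  right_distrib := by decide
  zero_mul := by decide
  mul_zero := by decide
  mul_assoc := by decide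
  one_mul := by decide
  mul_one := by decide
  mul_comm := by decide
  exists_pair_ne := ⟨0, 1, by decide⟩
  mul_inv_cancel := by decide
  inv_zero := rfl
  nsmul := nsmulRec
  zsmul := zsmulRec
  nnqsmul := _
  qsmul := _

/-- The elements of the field, numbered from `0` to `3`. -/
def ofIndex : ℕ → FourField
  | 0 => 0
  | 1 => 1
  | 2 => a
  | _ => b

end FourField

/-- Normalized homogeneous coordinates of the points of the projective plane of order four.
The point `0` is `[0 : 0 : 1]`, and the points `0, …, 4` form the line where the first
coordinate vanishes. -/
def planePoint (i : Fin 21) : Fin 3 → FourField :=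
  if i.val = 0 then ![0, 0, 1]
  else if i.val < 5 then ![0, 1, .ofIndex (i.val - 1)]
  else ![1, .ofIndex ((i.val - 5) / 4), .ofIndex ((i.val - 5) % 4)]

/-- The standard bilinear form, on the points of the plane. -/
def planeDot (i j : Fin 21) : FourField :=
  planePoint i 0 * planePoint j 0 + planePoint i 1 * planePoint j 1 +
    planePoint i 2 * planePoint j 2

theorem planePoint_ne_zero : ∀ i, planePoint i ≠ 0 := by decide +kernel

theorem eq_of_mul_planePoint_eq :
    ∀ (c : FourField) (i j : Fin 21), (∀ k, c * planePoint i k = planePoint j k) → i = j := by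
  decide +kernel

theorem exists_mul_planePoint_eq :
    ∀ x y z : FourField, ¬ (x = 0 ∧ y = 0 ∧ z = 0) →
      ∃ (c : FourField) (j : Fin 21), c ≠ 0 ∧
        c * planePoint j 0 = x ∧ c * planePoint j 1 = y ∧ c * planePoint j 2 = z := by
  decide +kernel

theorem card_planeLine :
    ∀ j, (Finset.univ.filter fun i => planeDot i j = 0).card = 5 := by
  decide +kernel

/-- The bit masks of the lines of the plane. -/
def lineMask : Fin 21 → ℕ :=
  ![139810, 481, 1082404, 544816, 329768, 31, 279618, 1118466, 559234, 7681, 590404, 295696,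
    1065608, 1966081, 168008, 149764, 197776, 122881, 1058896, 533768, 274564]

theorem testBit_lineMask :
    ∀ j i : Fin 21, (lineMask j).testBit i = decide (planeDot i j = 0) := by
  decide +kernel

/-- Bit masks of lines forming a basis of the Dolgachev–Kondō code. -/
def basisMasks : List ℕ :=
  [139810, 481, 1082404, 544816, 329768, 31, 279618, 1118466, 7681, 1966081]

/-- The `F₂`-span of the lines of the concrete plane. -/
def planeCode : Submodule (ZMod 2) (Fin 21 → ZMod 2) :=
  Submodule.span (ZMod 2) (Set.range fun j => maskWord 21 (lineMask j))

/-- The points other than `0` of the line formed by the points `0, …, 4`. -/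
def fourPoints : Finset (Fin 21) := {1, 2, 3, 4}

/-- The words of the code of the concrete plane that meet `fourPoints` evenly. -/
def planeSubcode : Submodule (ZMod 2) (Fin 21 → ZMod 2) :=
  planeCode ⊓ LinearMap.ker (∑ i ∈ fourPoints, LinearMap.proj i)

theorem mem_planeCode_iff (w : Fin 21 → ZMod 2) :
    w ∈ planeCode ↔ ∃ m ∈ xorSpan basisMasks, w = maskWord 21 m := by
  rw [← mem_span_maskWord_iff]
  have hspan : ∀ j, lineMask j ∈ xorSpan basisMasks := by decide +kernel
  have hbasis : ∀ m ∈ basisMasks, ∃ j, lineMask j = m := by decide +kernel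
  suffices h : planeCode = Submodule.span (ZMod 2) {v | ∃ g ∈ basisMasks, v = maskWord 21 g} by
    rw [h]
  refine le_antisymm (Submodule.span_le.2 ?_) (Submodule.span_mono ?_)
  · rintro _ ⟨j, rfl⟩
    exact (mem_span_maskWord_iff 21 basisMasks _).2 ⟨_, hspan j, rfl⟩
  · rintro _ ⟨m, hm, rfl⟩
    obtain ⟨j, rfl⟩ := hbasis m hm
    exact ⟨j, rfl⟩

/-- The bit masks of the words of `planeSubcode`. -/
def subcodeMasks : List ℕ :=
  (xorSpan basisMasks).filter fun m => bitCount 21 (m &&& 30) % 2 = 0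

theorem mem_planeSubcode_iff (w : Fin 21 → ZMod 2) :
    w ∈ planeSubcode ↔ ∃ m ∈ subcodeMasks, w = maskWord 21 m := by
  have key : ∀ m ∈ xorSpan basisMasks,
      bitCount 21 (m &&& 30) % 2 = 0 ↔ ∑ i ∈ fourPoints, maskWord 21 m i = 0 := by
    decide +kernel
  rw [planeSubcode, Submodule.mem_inf, mem_planeCode_iff, LinearMap.mem_ker]
  simp only [LinearMap.coe_sum, Finset.sum_apply, LinearMap.proj_apply, subcodeMasks,
    List.mem_filter, decide_eq_true_eq]
  constructor
  · rintro ⟨⟨m, hm, rfl⟩, h⟩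
    exact ⟨m, ⟨hm, (key m hm).2 h⟩, rfl⟩
  · rintro ⟨m, ⟨hm, h⟩, rfl⟩
    exact ⟨⟨m, hm, rfl⟩, (key m hm).1 h⟩

/-- The bit masks of the linear words of `planeSubcode`. -/
def linearMasks : List ℕ := subcodeMasks.filter fun m => bitCount 21 m = 5

/-- The bit masks of the quadratic words of `planeSubcode`. -/
def quadraticMasks : List ℕ :=
  subcodeMasks.filter fun m => bitCount 21 m = 8 ∧
    ¬ ∃ a ∈ linearMasks, ∃ b ∈ linearMasks, m = a ^^^ b

theorem isLinearWord_planeSubcode_iff (w : Fin 21 → ZMod 2) :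
    IsLinearWord planeSubcode w ↔ ∃ m ∈ linearMasks, w = maskWord 21 m := by
  simp only [IsLinearWord, mem_planeSubcode_iff, linearMasks, List.mem_filter,
    decide_eq_true_eq]
  constructor
  · rintro ⟨⟨m, hm, rfl⟩, h⟩
    exact ⟨m, ⟨hm, wt_maskWord 21 m ▸ h⟩, rfl⟩
  · rintro ⟨m, ⟨hm, h⟩, rfl⟩
    exact ⟨⟨m, hm, rfl⟩, (wt_maskWord 21 m).trans h⟩

theorem maskWord_inj_of_lt {n m m' : ℕ} (hm : m < 2 ^ n) (hm' : m' < 2 ^ n) :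
    maskWord n m = maskWord n m' ↔ m = m' := by
  refine ⟨fun h => Nat.eq_of_testBit_eq fun i => ?_, fun h => h ▸ rfl⟩
  by_cases hi : i < n
  · have := congrFun h ⟨i, hi⟩
    simp only [maskWord] at this
    revert this
    cases m.testBit i <;> cases m'.testBit i <;> decide
  · have hle : 2 ^ n ≤ 2 ^ i := Nat.pow_le_pow_right two_pos (not_lt.1 hi)
    rw [Nat.testBit_lt_two_pow (hm.trans_le hle), Nat.testBit_lt_two_pow (hm'.trans_le hle)]

theorem isQuadraticWord_planeSubcode_iff (w : Fin 21 → ZMod 2) :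
    IsQuadraticWord planeSubcode w ↔ ∃ m ∈ quadraticMasks, w = maskWord 21 m := by
  have hlt : ∀ m ∈ subcodeMasks, m < 2 ^ 21 := by decide +kernel
  have hlin : ∀ m ∈ linearMasks, m < 2 ^ 21 := fun m hm => hlt m (List.mem_of_mem_filter hm)
  have hsum : ∀ m ∈ subcodeMasks,
      (∃ l₁ l₂, IsLinearWord planeSubcode l₁ ∧ IsLinearWord planeSubcode l₂ ∧
        maskWord 21 m = l₁ + l₂) ↔ ∃ a ∈ linearMasks, ∃ b ∈ linearMasks, m = a ^^^ b := by
    intro m hm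
    simp only [isLinearWord_planeSubcode_iff]
    constructor
    · rintro ⟨_, _, ⟨a, ha, rfl⟩, ⟨b, hb, rfl⟩, h⟩
      refine ⟨a, ha, b, hb, ?_⟩
      rwa [← maskWord_xor, maskWord_inj_of_lt (hlt m hm)
        (Nat.xor_lt_two_pow (hlin a ha) (hlin b hb))] at h
    · rintro ⟨a, ha, b, hb, rfl⟩
      exact ⟨_, _, ⟨a, ha, rfl⟩, ⟨b, hb, rfl⟩, maskWord_xor 21 a b⟩
  rw [IsQuadraticWord, mem_planeSubcode_iff]
  simp only [quadraticMasks, List.mem_filter, decide_eq_true_eq]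
  constructor
  · rintro ⟨⟨m, hm, rfl⟩, h, hs⟩
    exact ⟨m, ⟨hm, wt_maskWord 21 m ▸ h, mt (hsum m hm).2 hs⟩, rfl⟩
  · rintro ⟨m, ⟨hm, h, hs⟩, rfl⟩
    exact ⟨⟨m, hm, rfl⟩, (wt_maskWord 21 m).trans h, mt (hsum m hm).1 hs⟩

/-- The pairs `(m, d)` such that a Cremona center meets the bit mask `m` in fewer than `8 - d`
points. -/
def centerBounds : List (ℕ × ℕ) :=
  linearMasks.map (·, 5) ++ quadraticMasks.map (·, 3)

theorem centerBounds_eq : centerBounds =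
    [(1966081, 5), (7681, 5), (31, 5), (481, 5), (122881, 5), (1398080, 3), (740160, 3),
    (1317162, 3), (657194, 3), (85098, 3), (661812, 3), (1312564, 3), (86644, 3), (1655090, 3),
    (791666, 3), (1182322, 3), (475436, 3), (1184876, 3), (789100, 3), (874520, 3), (1263128, 3),
    (1576280, 3), (398168, 3), (1267718, 3), (869894, 3), (396614, 3), (1577798, 3), (103718, 3),
    (1359974, 3), (101176, 3), (704632, 3), (1412108, 3), (758284, 3), (55628, 3), (756754, 3),
    (1413650, 3), (51026, 3), (1627156, 3), (444948, 3), (885076, 3), (447498, 3), (1624586, 3),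
    (1278282, 3), (1232160, 3), (840480, 3), (497760, 3), (1672800, 3), (742560, 3), (1395360, 3),
    (661706, 3), (1312458, 3), (86922, 3), (1317076, 3), (657108, 3), (85396, 3), (475346, 3),
    (1185170, 3), (789394, 3), (1654988, 3), (791948, 3), (1182604, 3), (396472, 3), (1577656, 3),
    (1576102, 3), (397990, 3), (101062, 3), (704902, 3), (103640, 3), (1360280, 3), (50860, 3),
    (55474, 3), (1278132, 3), (884906, 3), (838848, 3), (1233600, 3), (1677696, 3), (493440, 3),
    (1258272, 3), (863520, 3), (419424, 3), (1603680, 3), (469514, 3), (1651722, 3), (811338, 3),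
    (1649172, 3), (472084, 3), (1204564, 3), (684562, 3), (1338386, 3), (80210, 3), (1339916, 3),
    (683020, 3), (75596, 3), (30008, 3), (1384568, 3), (27430, 3), (729190, 3), (1222150, 3),
    (833542, 3), (828952, 3), (1226776, 3), (1614124, 3), (434482, 3), (44148, 3), (45674, 3),
    (1354560, 3), (701760, 3), (864960, 3), (1256640, 3), (1599360, 3), (424320, 3), (1204394, 3),
    (811188, 3), (75442, 3), (80044, 3), (27352, 3), (729496, 3), (29894, 3), (1384838, 3),
    (434380, 3), (1614034, 3), (45972, 3), (44426, 3), (699040, 3), (1356960, 3)] := by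
  decide +kernel

/-- For each point of the plane, the packed indicator of the masks of `centerBounds` that
contain it. -/
def packedIncidence : List ℕ :=
  [69905,
    802302333918801689309183264142970617976805381367229840533775644852846755161290366367722398091585200953433528941270850467941969966429053039010644224,
    50156042752165016195493193608926916267704263793219494310881657520934467989886524989157712141135803543013665473076346041548322124289541030960693504,
    799362788962638951739962357183363278254683059233952742291830761906292734786893436570988119077371387799314590356047192623068275894166367117265338624,
    53069775978962176398222713471447816016750233895463627626263178045078172886126590046111408333403778261623463970921762388417458536636598651839316224,
    217373595055801643454716527971103900749601156208424732718451387427892695555547286090680973474691607561141621472942697377067023703057533393251250212864,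
    3317622957484335280996291850262984072418863035107055813198392831083228337975460419633458364019585919909914703841930417215138469223674430874456064,
    218226040526409458000833101960271263233449829499801934570530249335815431379931110472289949187185973853029566843897143415385143413658537276125015445504,
    849127847650330210928000014945744312710145604123390415225002942630205904195798488468809826740775424254562801243142967837978249050128378348377739264,
    12836630041888121067891568105848872749797997664977610886484870150166884450649246112941059280051669197248348587710241904924288449505790437714504450064,
    205386081384547032662221938258692117835938897439480890293376004694296419282102202511937865591512495149835302432114027270682929913063699432705520304144,
    13585849694138403169414356152664197377731471915581181934152491069627714173819450064954517776093934963351364515218461869822577279664713399403091591184,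
    204636861732645638471886854236165630509531961641157168204939850759910498008377077899746984639296271416224127362322964007673331995137867199382387949584,
    218226040526409458000879313121839943481109469736204319298851325792412811197772655519135819434444998749473880296493147936945502328876398590436371922944,
    765123548864514287974105569847226975240426690459013470093099081261455472501056238120597797406214616684405982116343792234853927859170221031424,
    218226027519123831684291226860086790895102893199336616492288895171985901284821097693006631799567692585672250524007730800452347846564983439134396841984,
    12242162077452073798287647582738779601296441012347618491355320045529550938372036135651825716733977947426057519905460023754109353959230404624384,
    12786877219012849842458414441338017548995743004633124731217163702476073649210848471721645810106669631214657526774901146248142085418592912728525897729,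
    204587120297124265975817409392526768546381794302665346499267498442035939841927988817930260230870967724293285416792692031060977254089313132289083834369,
    12789803858279449824318943489114144194703203668607419038159452269160735078909650377781175833304534903050890607320104012497784469702643766620709715969,
    204590046936389503155864906888112032215226255666448143740936626809284686125060100165662369488183596091679847207286123027242502682727981217632069091329]

theorem map_packDigits_centerBounds :
    ((List.finRange 21).map fun p : Fin 21 =>
      packDigits (centerBounds.map fun c => (c.1.testBit p).toNat)) = packedIncidence := by
  rw [centerBounds_eq]
  decide +kernel

theorem packDigits_centerBounds_eight :
    packDigits (centerBounds.map fun _ => 8) =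
      1745808324211275664007034504974719547848875757889634554391088729651271358082493095937744049240482217147139564868032037871582536824472209628441881381000 := by
  rw [centerBounds_eq]
  decide +kernel

theorem packDigits_centerBounds_snd :
    packDigits (centerBounds.map fun c => c.2) =
      654678121579228374002637939365519830443328409208612957896658273619226759280934910976654018465180831430177336825512014201843451309177078610665705657685 := by
  rw [centerBounds_eq]
  decide +kernel

theorem countP_sublistsLen_centerBounds :
    ((List.finRange 21).sublistsLen 6).countP (fun s => ∀ c ∈ centerBounds,
      c.2 + (s.map fun p : Fin 21 => (c.1.testBit p).toNat).sum < 8) = 2224 := by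
  have h := countPacked_eq_countP centerBounds (fun (p : Fin 21) c => (c.1.testBit p).toNat)
    (fun p c _ => (Bool.toNat_le _).trans (by norm_num)) (List.finRange 21) 6 (fun c => c.2)
    (by rw [centerBounds_eq]; decide +kernel)
  rw [← h, map_packDigits_centerBounds, packDigits_centerBounds_eight,
    packDigits_centerBounds_snd]
  decide +kernel

theorem isCremonaCenter_planeSubcode_iff (s : Finset (Fin 21)) :
    IsCremonaCenter planeSubcode (fun i => if i ∈ s then 1 else 0) ↔
      s.card = 6 ∧ ∀ c ∈ centerBounds, c.2 + (s.filter fun i : Fin 21 => c.1.testBit i).card < 8 := by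
  have hs : {x : Fin 21 | (if x ∈ s then (1 : ZMod 2) else 0) = 1} = s := by
    ext x
    simp
  have hinter (m : ℕ) : ((s : Set (Fin 21)) ∩ {x | maskWord 21 m x = 1}).ncard =
      (s.filter fun i : Fin 21 => m.testBit i).card := by
    rw [setOf_maskWord_eq_one, ← Set.ncard_coe_finset]
    congr 1
    ext x
    simp
  simp only [IsCremonaCenter, isLinearWord_planeSubcode_iff, isQuadraticWord_planeSubcode_iff,
    wt, hs, Set.ncard_coe_finset, centerBounds, List.forall_mem_append, List.forall_mem_map]
  refine and_congr_right fun _ => and_congr ⟨fun h m hm => ?_, ?_⟩ ⟨fun h m hm => ?_, ?_⟩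
  · have := h _ ⟨m, hm, rfl⟩
    rw [hinter] at this
    omega
  · rintro h _ ⟨m, hm, rfl⟩
    have := h m hm
    rw [hinter]
    omega
  · have := h _ ⟨m, hm, rfl⟩
    rw [hinter] at this
    omega
  · rintro h _ ⟨m, hm, rfl⟩
    have := h m hm
    rw [hinter]
    omega

theorem ncard_isCremonaCenter_planeSubcode :
    {c | IsCremonaCenter planeSubcode c}.ncard = 2224 := by
  have himage : {c | IsCremonaCenter planeSubcode c} =
      (fun (s : Finset (Fin 21)) i => if i ∈ s then (1 : ZMod 2) else 0) ''
        ((Finset.univ.powersetCard 6).filter fun s =>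
          ∀ c ∈ centerBounds, c.2 + (s.filter fun i : Fin 21 => c.1.testBit i).card < 8) := by
    ext c
    have hc : c = fun i => if i ∈ Finset.univ.filter (fun i => c i = 1) then 1 else 0 := by
      funext i
      have hi : c i = 0 ∨ c i = 1 := by generalize c i = x; revert x; decide
      rcases hi with hi | hi <;> simp [hi]
    constructor
    · intro h
      refine ⟨_, ?_, hc.symm⟩
      rw [Set.mem_ofPred_eq, hc, isCremonaCenter_planeSubcode_iff] at h
      simpa using h
    · rintro ⟨s, hs, rfl⟩
      rw [Set.mem_ofPred_eq, isCremonaCenter_planeSubcode_iff]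
      simpa using hs
  rw [himage, Set.ncard_image_of_injective, Set.ncard_coe_finset,
    ← countP_sublistsLen_centerBounds]
  · refine card_filter_powersetCard_univ 21 6 _ _ fun s l hl => forall₂_congr fun c _ => ?_
    rw [Finset.card_filter, Finset.sum, hl, Multiset.map_coe, Multiset.sum_coe]
    have : (fun i : Fin 21 => if c.1.testBit i = true then 1 else 0) =
        fun p : Fin 21 => (c.1.testBit p).toNat := by
      funext i
      cases c.1.testBit i <;> rfl
    rw [this]
  · intro s t hst
    ext i
    have := congrFun hst i
    by_cases hs : i ∈ s <;> by_cases ht : i ∈ t <;> simp_all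

/-! ### Coordinates on an abstract plane of order four -/

theorem isCremonaCenter_comp_equiv {S T : Type*} (σ : S ≃ T)
    {C : Submodule (ZMod 2) (T → ZMod 2)} {D : Submodule (ZMod 2) (S → ZMod 2)}
    (h : ∀ w, w ∈ C ↔ w ∘ σ ∈ D) (c : T → ZMod 2) :
    IsCremonaCenter C c ↔ IsCremonaCenter D (c ∘ σ) := by
  have hncard (A : Set T) : (σ ⁻¹' A).ncard = A.ncard := by
    rw [← Set.ncard_image_of_injective _ σ.injective, Set.image_preimage_eq _ σ.surjective]
  have hwt (w : T → ZMod 2) : wt (w ∘ σ) = wt w := hncard {x | w x = 1}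
  have hinter (v w : T → ZMod 2) :
      ({x | (v ∘ σ) x = 1} ∩ {x | (w ∘ σ) x = 1}).ncard =
        ({x | v x = 1} ∩ {x | w x = 1}).ncard :=
    hncard ({x | v x = 1} ∩ {x | w x = 1})
  have hforall (p : (S → ZMod 2) → Prop) : (∀ v, p v) ↔ ∀ w : T → ZMod 2, p (w ∘ σ) :=
    (σ.arrowCongr (Equiv.refl (ZMod 2))).symm.surjective.forall
  have hexists (p : (S → ZMod 2) → Prop) : (∃ v, p v) ↔ ∃ w : T → ZMod 2, p (w ∘ σ) :=
    (σ.arrowCongr (Equiv.refl (ZMod 2))).symm.surjective.exists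
  have hlin (w : T → ZMod 2) : IsLinearWord D (w ∘ σ) ↔ IsLinearWord C w := by
    rw [IsLinearWord, IsLinearWord, h, hwt]
  have hadd (u v w : T → ZMod 2) : u ∘ σ = v ∘ σ + w ∘ σ ↔ u = v + w :=
    σ.surjective.injective_comp_right.eq_iff (b := v + w)
  have hquad (w : T → ZMod 2) : IsQuadraticWord D (w ∘ σ) ↔ IsQuadraticWord C w := by
    simp only [IsQuadraticWord, h, hwt, hexists, hlin, hadd]
  simp only [IsCremonaCenter, hforall, hlin, hquad, hinter, hwt]

section Coordinates

open Projectivization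

variable {F : Type*} [Field F]

theorem map_rep_mk_eq_zero_iff {v : Fin 3 → F} (hv : v ≠ 0) (φ : (Fin 3 → F) →ₗ[F] F) :
    φ (mk F v hv).rep = 0 ↔ φ v = 0 := by
  obtain ⟨a, ha⟩ := exists_smul_eq_mk_rep F v hv
  rw [← ha, Units.smul_def, map_smul, smul_eq_zero_iff_right a.ne_zero]

theorem coordVector_ne_zero (ψ : FourField ≃+* F) (A : (Fin 3 → F) ≃ₗ[F] (Fin 3 → F))
    (i : Fin 21) : A (fun k => ψ (planePoint i k)) ≠ 0 := by
  rw [ne_eq, LinearEquiv.map_eq_zero_iff]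
  intro h
  refine planePoint_ne_zero i (funext fun k => ?_)
  simpa using congrFun h k

/-- The point with the normalized coordinates `planePoint i` in the frame `A`. -/
def coordPoint (ψ : FourField ≃+* F) (A : (Fin 3 → F) ≃ₗ[F] (Fin 3 → F)) (i : Fin 21) :
    Projectivization F (Fin 3 → F) :=
  mk F _ (coordVector_ne_zero ψ A i)

theorem coordPoint_injective (ψ : FourField ≃+* F) (A : (Fin 3 → F) ≃ₗ[F] (Fin 3 → F)) :
    Function.Injective (coordPoint ψ A) := by
  intro i j h
  rw [coordPoint, coordPoint, mk_eq_mk_iff'] at h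
  obtain ⟨a, ha⟩ := h
  rw [← map_smul] at ha
  refine (eq_of_mul_planePoint_eq (ψ.symm a) j i fun k => ψ.injective ?_).symm
  simpa using congrFun (A.injective ha) k

theorem coordPoint_bijective [Fintype F] (hF : Fintype.card F = 4) (ψ : FourField ≃+* F)
    (A : (Fin 3 → F) ≃ₗ[F] (Fin 3 → F)) : Function.Bijective (coordPoint ψ A) := by
  have hcard : Nat.card (Projectivization F (Fin 3 → F)) = 21 := by
    rw [card_of_finrank F (Fin 3 → F) (n := 3) (by simp), Nat.card_eq_fintype_card, hF]
    rfl
  have : Finite (Projectivization F (Fin 3 → F)) := Nat.finite_of_card_ne_zero (by omega)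
  refine (Nat.bijective_iff_injective_and_card _).2 ⟨coordPoint_injective ψ A, ?_⟩
  rw [hcard, Nat.card_fin]

/-- The line dual to the point `j` has an equation in any frame. -/
theorem exists_functional_planeDot (ψ : FourField ≃+* F)
    (A : (Fin 3 → F) ≃ₗ[F] (Fin 3 → F)) (j : Fin 21) :
    ∃ φ : (Fin 3 → F) →ₗ[F] F, φ ≠ 0 ∧
      ∀ i, φ (coordPoint ψ A i).rep = 0 ↔ planeDot i j = 0 := by
  let θ : (Fin 3 → F) →ₗ[F] F := ∑ k, ψ (planePoint j k) • LinearMap.proj k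
  have hθ (v : Fin 3 → F) : θ v = ∑ k, ψ (planePoint j k) * v k := by simp [θ]
  refine ⟨θ ∘ₗ A.symm.toLinearMap, fun h => planePoint_ne_zero j (funext fun k => ?_), fun i => ?_⟩
  · have := LinearMap.congr_fun h (A (Pi.single k 1))
    simpa [hθ, Pi.single_apply] using this
  · rw [coordPoint, map_rep_mk_eq_zero_iff, LinearMap.comp_apply, LinearEquiv.coe_coe,
      LinearEquiv.symm_apply_apply, hθ, ← map_eq_zero_iff ψ ψ.injective, planeDot]
    simp [Fin.sum_univ_three, mul_comm]

/-- In any frame, each line is dual to one of the points. -/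
theorem exists_planeDot_eq_zero_iff (ψ : FourField ≃+* F)
    (A : (Fin 3 → F) ≃ₗ[F] (Fin 3 → F)) {φ : (Fin 3 → F) →ₗ[F] F} (hφ : φ ≠ 0) :
    ∃ j, ∀ i, φ (coordPoint ψ A i).rep = 0 ↔ planeDot i j = 0 := by
  have hexp (v : Fin 3 → F) : φ (A v) = ∑ k, v k * φ (A (Pi.single k 1)) := by
    conv_lhs => rw [pi_eq_sum_univ' v]
    simp only [map_sum, map_smul, smul_eq_mul]
  obtain ⟨c, j, hc, h0, h1, h2⟩ := exists_mul_planePoint_eq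
    (ψ.symm (φ (A (Pi.single 0 1)))) (ψ.symm (φ (A (Pi.single 1 1))))
    (ψ.symm (φ (A (Pi.single 2 1)))) (by
      rintro ⟨h0, h1, h2⟩
      rw [map_eq_zero_iff _ ψ.symm.injective] at h0 h1 h2
      refine hφ (LinearMap.ext fun v => ?_)
      rw [← A.apply_symm_apply v, hexp, Fin.sum_univ_three, h0, h1, h2]
      simp)
  rw [RingEquiv.eq_symm_apply] at h0 h1 h2
  refine ⟨j, fun i => ?_⟩
  rw [coordPoint, map_rep_mk_eq_zero_iff, hexp, Fin.sum_univ_three, ← h0, ← h1, ← h2,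
    ← map_mul, ← map_mul, ← map_mul, ← map_add, ← map_add, map_eq_zero_iff ψ ψ.injective]
  have : planePoint i 0 * (c * planePoint j 0) + planePoint i 1 * (c * planePoint j 1) +
      planePoint i 2 * (c * planePoint j 2) = c * planeDot i j := by
    rw [planeDot]
    ring
  rw [this, mul_eq_zero_iff_left hc]

/-- A four-point subset of a line is a line with one point removed; in a suitable frame, it
is the set `fourPoints`. -/
theorem exists_frame_fourPoints [Fintype F] (hF : Fintype.card F = 4) (ψ : FourField ≃+* F)
    (Fs : Finset (Projectivization F (Fin 3 → F))) (hcard : Fs.card = 4)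
    (hconf : CollinSet F ↑Fs) :
    ∃ A : (Fin 3 → F) ≃ₗ[F] (Fin 3 → F), ∀ i, coordPoint ψ A i ∈ Fs ↔ i ∈ fourPoints := by
  classical
  obtain ⟨_, ⟨φ, hφ, rfl⟩, hL⟩ := hconf
  obtain ⟨p, hp, hpF⟩ : ∃ p : Projectivization F (Fin 3 → F), φ p.rep = 0 ∧ p ∉ Fs := by
    by_contra! hcon
    obtain ⟨j, hj⟩ := exists_planeDot_eq_zero_iff ψ (LinearEquiv.refl F _) hφ
    have hle := Finset.card_le_card_of_injOn (s := Finset.univ.filter fun i => planeDot i j = 0)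
      (t := Fs) (coordPoint ψ (LinearEquiv.refl F _))
      (fun i hi => hcon _ ((hj i).2 (by simpa using hi))) (coordPoint_injective ψ _).injOn
    rw [card_planeLine, hcard] at hle
    omega
  obtain ⟨q, hqF⟩ : Fs.Nonempty := Finset.card_pos.1 (by omega)
  have hq : φ q.rep = 0 := hL hqF
  obtain ⟨v, hv⟩ : ∃ v, φ v ≠ 0 := by
    by_contra! hcon
    exact hφ (LinearMap.ext hcon)
  have hpq : LinearIndependent F ![q.rep, p.rep] := by
    have := (independent_pair_iff_ne q p).2 (fun h => hpF (h ▸ hqF))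
    rw [independent_iff] at this
    have hrep : Projectivization.rep ∘ ![q, p] = ![q.rep, p.rep] := by
      ext i : 1
      fin_cases i <;> rfl
    rwa [hrep] at this
  have hli : LinearIndependent F ![v, q.rep, p.rep] := by
    refine linearIndependent_finCons.2 ⟨hpq, fun hmem => hv ?_⟩
    have hle : Submodule.span F (Set.range ![q.rep, p.rep]) ≤ LinearMap.ker φ := by
      rw [Submodule.span_le]
      rintro _ ⟨i, rfl⟩
      fin_cases i <;> simpa
    exact hle hmem
  let b : Module.Basis (Fin 3) F (Fin 3 → F) :=
    basisOfLinearIndependentOfCardEqFinrank hli (by simp)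
  have hA (w : Fin 3 → F) : b.equivFun.symm w = w 0 • v + w 1 • q.rep + w 2 • p.rep := by
    simp [b, Module.Basis.equivFun_symm_apply, Fin.sum_univ_three]
  refine ⟨b.equivFun.symm, ?_⟩
  have hline (i : Fin 21) : φ (coordPoint ψ b.equivFun.symm i).rep = 0 ↔ planePoint i 0 = 0 := by
    rw [coordPoint, map_rep_mk_eq_zero_iff, hA]
    simp [hp, hq, hv]
  have hzero : coordPoint ψ b.equivFun.symm 0 = p := by
    rw [coordPoint]
    conv_rhs => rw [← mk_rep p]
    congr 1
    rw [hA]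
    simp [planePoint]
  have hfour : ∀ i, i ∈ fourPoints ↔ planePoint i 0 = 0 ∧ i ≠ 0 := by decide +kernel
  have himage : Fs = fourPoints.image (coordPoint ψ b.equivFun.symm) := by
    refine Finset.eq_of_subset_of_card_le (fun x hx => ?_) ?_
    · obtain ⟨i, rfl⟩ := (coordPoint_bijective hF ψ b.equivFun.symm).2 x
      refine Finset.mem_image_of_mem _ ((hfour i).2 ⟨(hline i).1 (hL hx), ?_⟩)
      rintro rfl
      exact hpF (hzero ▸ hx)
    · rw [Finset.card_image_of_injective _ (coordPoint_injective ψ _), hcard]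
      decide
  intro i
  rw [himage, (coordPoint_injective ψ _).mem_finset_image]

theorem mem_CF_iff_comp_mem_planeSubcode (ψ : FourField ≃+* F)
    (A : (Fin 3 → F) ≃ₗ[F] (Fin 3 → F)) (σ : Fin 21 ≃ Projectivization F (Fin 3 → F))
    (hσ : ∀ i, σ i = coordPoint ψ A i) (Fs : Finset (Projectivization F (Fin 3 → F)))
    (hFs : ∀ i, σ i ∈ Fs ↔ i ∈ fourPoints) (w : Projectivization F (Fin 3 → F) → ZMod 2) :
    w ∈ CF F Fs ↔ w ∘ σ ∈ planeSubcode := by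
  have hFs' : Fs = fourPoints.map σ.toEmbedding := by
    ext x
    obtain ⟨i, rfl⟩ := σ.surjective x
    simp [hFs]
  have hind (L : Set (Projectivization F (Fin 3 → F))) (j : Fin 21)
      (h : ∀ i, σ i ∈ L ↔ planeDot i j = 0) :
      Set.indicator L (fun _ => (1 : ZMod 2)) ∘ σ = maskWord 21 (lineMask j) := by
    classical
    funext i
    simp [maskWord, testBit_lineMask, Set.indicator_apply, h]
  let T := LinearEquiv.funCongrLeft (ZMod 2) (ZMod 2) σ
  have hT (u : Projectivization F (Fin 3 → F) → ZMod 2) : T u = u ∘ σ := rfl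
  have hmap : (CDK F).map T.toLinearMap = planeCode := by
    rw [CDK, Submodule.map_span, planeCode]
    congr 1
    ext u
    simp only [Set.mem_image, Set.mem_ofPred_eq, Set.mem_range]
    constructor
    · rintro ⟨_, ⟨L, ⟨φ, hφ, rfl⟩, rfl⟩, rfl⟩
      obtain ⟨j, hj⟩ := exists_planeDot_eq_zero_iff ψ A hφ
      exact ⟨j, (hind _ j fun i => by rw [hσ]; exact hj i).symm⟩
    · rintro ⟨j, rfl⟩
      obtain ⟨φ, hφ, hj⟩ := exists_functional_planeDot ψ A j
      exact ⟨_, ⟨_, ⟨φ, hφ, rfl⟩, rfl⟩, hind _ j fun i => by rw [hσ]; exact hj i⟩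
  have hmem : w ∈ CDK F ↔ w ∘ σ ∈ planeCode := by
    rw [← hmap, ← hT]
    exact (Submodule.mem_map_equiv (e := T) (p := CDK F) (x := T w)).trans
      (by rw [LinearEquiv.symm_apply_apply]) |>.symm
  rw [CF, planeSubcode, Submodule.mem_inf, Submodule.mem_inf, hmem, LinearMap.mem_ker,
    LinearMap.mem_ker, hFs']
  simp

end Coordinates

/-- for a four-point subset `F ⊆ P²(F₄)` consisting of four collinear points,
there are exactly 2224 words of weight 6 that are centers of Cremona transformation with
respect to the code `C_F`. -/
theorem count_centers_C (F : Type*) [Field F] [Fintype F] (hF : Fintype.card F = 4)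
    (Fs : Finset (Projectivization F (Fin 3 → F))) (hcard : Fs.card = 4)
    (hconf : CollinSet F ↑Fs) :
    {c : Projectivization F (Fin 3 → F) → ZMod 2 | IsCremonaCenter (CF F Fs) c}.ncard
      = 2224 := by
  let ψ : FourField ≃+* F := FiniteField.ringEquivOfCardEq (by rw [hF]; rfl)
  obtain ⟨A, hA⟩ := exists_frame_fourPoints hF ψ Fs hcard hconf
  let σ := Equiv.ofBijective _ (coordPoint_bijective hF ψ A)
  have h := isCremonaCenter_comp_equiv σ
    (mem_CF_iff_comp_mem_planeSubcode ψ A σ (fun _ => rfl) Fs hA)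
  rw [← ncard_isCremonaCenter_planeSubcode]
  refine Set.ncard_congr (fun c _ => c ∘ σ) (fun c hc => (h c).1 hc)
    (fun c d _ _ hcd => σ.surjective.injective_comp_right hcd) fun d hd => ?_
  have hd' : (d ∘ σ.symm) ∘ σ = d := by
    funext i
    simp
  refine ⟨d ∘ σ.symm, (h _).2 ?_, hd'⟩
  rw [hd']
  exact hd
end

section
/- Let F ⊆ P²(F₄) be a four-point subset having exactly one collinear triple of points. Then the group of permutations σ of the 21-point set P²(F₄) satisfying σ(C_F) = C_F has order 432 and is isomorphic to the group of invertible affine transformations of the affine plane over the three-element field F₃ (the automorphism group of the Hesse configuration). -/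
/-- The group of permutations of `S` preserving a code `C ⊆ Pow(S) = F₂^S`. -/
def codeAut (S : Type*) (C : Submodule (ZMod 2) (S → ZMod 2)) : Subgroup (Equiv.Perm S) where
  carrier := {σ | Submodule.map (LinearMap.funLeft (ZMod 2) (ZMod 2) ⇑σ) C = C}
  one_mem' := by
    show Submodule.map (LinearMap.funLeft (ZMod 2) (ZMod 2) ⇑(1 : Equiv.Perm S)) C = C
    rw [Equiv.Perm.coe_one]
    have : LinearMap.funLeft (ZMod 2) (ZMod 2) (id : S → S) = LinearMap.id := by
      ext w x; rfl
    rw [this, Submodule.map_id]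
  mul_mem' := by
    intro a b ha hb
    show Submodule.map (LinearMap.funLeft (ZMod 2) (ZMod 2) ⇑(a * b)) C = C
    have hc : (⇑(a * b) : S → S) = ⇑a ∘ ⇑b := rfl
    rw [hc, LinearMap.funLeft_comp, Submodule.map_comp]
    rw [show Submodule.map (LinearMap.funLeft (ZMod 2) (ZMod 2) ⇑a) C = C from ha]
    exact hb
  inv_mem' := by
    intro a ha
    show Submodule.map (LinearMap.funLeft (ZMod 2) (ZMod 2) ⇑a⁻¹) C = C
    conv_lhs => rw [← show Submodule.map (LinearMap.funLeft (ZMod 2) (ZMod 2) ⇑a) C = C from ha]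
    rw [← Submodule.map_comp, ← LinearMap.funLeft_comp]
    have : (⇑a : S → S) ∘ ⇑a⁻¹ = id := by funext x; simp
    rw [this]
    have h2 : LinearMap.funLeft (ZMod 2) (ZMod 2) (id : S → S) = LinearMap.id := by
      ext w x; rfl
    rw [h2, Submodule.map_id]

/-- The points of the affine plane over the field with three elements. -/
abbrev AffPlane : Type := Fin 2 → ZMod 3

/-- The points and the lines of the affine plane over the field with three elements, as sets of
points. Three distinct points form a line if and only if their sum vanishes. -/
def IsFlat (s : Finset AffPlane) : Prop := s.card = 1 ∨ s.card = 3 ∧ ∑ x ∈ s, x = 0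

instance : DecidablePred IsFlat := fun _ => inferInstanceAs (Decidable (_ ∨ _))

/-- The type of points and lines of the affine plane. -/
abbrev Flat : Type := {s : Finset AffPlane // IsFlat s}

/-- An explicit enumeration of the nine points and twelve lines of the affine plane: points,
graphs of affine functions, and vertical lines. -/
def flatPoints : (ZMod 3 × ZMod 3) ⊕ (ZMod 3 × ZMod 3) ⊕ ZMod 3 → Finset AffPlane
  | .inl p => {![p.1, p.2]}
  | .inr (.inl p) => {![0, p.2], ![1, p.1 + p.2], ![2, p.1 * 2 + p.2]}
  | .inr (.inr c) => {![c, 0], ![c, 1], ![c, 2]}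

theorem isFlat_flatPoints : ∀ m, IsFlat (flatPoints m) := by decide +kernel

theorem flatPoints_injective : Function.Injective flatPoints := by
  have : ∀ m n, flatPoints m = flatPoints n → m = n := by decide +kernel
  exact this

theorem exists_flatPoints_eq {s : Finset AffPlane} (hs : IsFlat s) : ∃ m, flatPoints m = s := by
  rcases hs with h | ⟨h, h0⟩
  · obtain ⟨p, rfl⟩ := Finset.card_eq_one.1 h
    refine ⟨.inl (p 0, p 1), ?_⟩
    simp only [flatPoints, Finset.singleton_inj]
    ext i; fin_cases i <;> rfl
  · obtain ⟨p, q, r, hpq, hpr, hqr, rfl⟩ := Finset.card_eq_three.1 h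
    have hr : r = -(p + q) := by
      rw [Finset.sum_insert (by simp [hpq, hpr]), Finset.sum_pair hqr] at h0
      linear_combination (exp := 1) h0
    subst hr
    have key : ∀ p q : AffPlane, p ≠ q → ∃ m, flatPoints m = {p, q, -(p + q)} := by
      decide +kernel
    exact key p q hpq

/-- The enumeration of the points and lines as an equivalence. -/
noncomputable def flatEquiv : (ZMod 3 × ZMod 3) ⊕ (ZMod 3 × ZMod 3) ⊕ ZMod 3 ≃ Flat :=
  Equiv.ofBijective (fun m => ⟨flatPoints m, isFlat_flatPoints m⟩)
    ⟨fun _ _ h => flatPoints_injective (congrArg Subtype.val h),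
      fun s => (exists_flatPoints_eq s.2).imp fun _ h => Subtype.ext h⟩

theorem card_flat : Nat.card Flat = 21 := by
  rw [← Nat.card_congr flatEquiv]
  simp

/-- The word of all points and lines containing a given point. -/
def flatWord (p : AffPlane) : Flat → ZMod 2 := fun s => if p ∈ s.1 then 1 else 0

/-- The code spanned by the pencils of points and lines containing a given point. -/
def flatCode : Submodule (ZMod 2) (Flat → ZMod 2) := Submodule.span (ZMod 2) (Set.range flatWord)

theorem mem_flatCode_iff {w : Flat → ZMod 2} :
    w ∈ flatCode ↔ ∃ u : AffPlane → ZMod 2, w = fun s => ∑ p ∈ s.1, u p := by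
  rw [flatCode, Submodule.mem_span_range_iff_exists_fun]
  refine exists_congr fun u => ?_
  rw [eq_comm]
  refine Eq.congr rfl ?_
  ext s
  simp [flatWord, Finset.sum_ite_mem]

theorem flatWord_mem (p : AffPlane) : flatWord p ∈ flatCode :=
  Submodule.subset_span ⟨p, rfl⟩

theorem flatWord_injective : Function.Injective flatWord := by
  intro p q h
  have := congrFun h ⟨{p}, Or.inl (Finset.card_singleton p)⟩
  by_contra hpq
  simp [flatWord, Ne.symm hpq] at this

/-- The weight of a word. -/
def wordWeight {S : Type*} [Fintype S] (w : S → ZMod 2) : ℕ := ∑ s, (w s).val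

theorem wordWeight_comp {S : Type*} [Fintype S] (w : S → ZMod 2) (σ : Equiv.Perm S) :
    wordWeight (w ∘ σ) = wordWeight w :=
  Equiv.sum_comp σ fun s => (w s).val

theorem wordWeight_flat (w : Flat → ZMod 2) :
    wordWeight w = ∑ m, (w ⟨flatPoints m, isFlat_flatPoints m⟩).val :=
  (Equiv.sum_comp flatEquiv fun s => (w s).val).symm

theorem wordWeight_flatWord (p : AffPlane) : wordWeight (flatWord p) = 5 := by
  rw [wordWeight_flat]
  revert p
  unfold flatWord
  decide +kernel

/-- A word of `flatCode` of weight five has a single nonzero coefficient: the hypothesis is the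
weight of the word with the given coefficients at the nine points. -/
theorem card_eq_one_of_weight_eq_five : ∀ a b c d e f g h i : ZMod 2,
    a.val + b.val + c.val + d.val + e.val + f.val + g.val + h.val + i.val +
    ((a + d + g).val + (b + e + h).val + (c + f + i).val +
     (a + e + i).val + (b + f + g).val + (c + d + h).val +
     (a + f + h).val + (b + d + i).val + (c + e + g).val +
     ((a + b + c).val + (d + e + f).val + (g + h + i).val)) = 5 →
    a.val + b.val + c.val + d.val + e.val + f.val + g.val + h.val + i.val = 1 := by
  decide +kernel

theorem exists_flatWord_of_weight {w : Flat → ZMod 2} (hw : w ∈ flatCode)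
    (h5 : wordWeight w = 5) : ∃ p, w = flatWord p := by
  obtain ⟨u, rfl⟩ := mem_flatCode_iff.1 hw
  have hsum : ∑ p, (u p).val = 1 := by
    rw [wordWeight_flat] at h5
    have hpts : ∑ p, (u p).val = ∑ x : ZMod 3 × ZMod 3, (u ![x.1, x.2]).val :=
      ((finTwoArrowEquiv (ZMod 3)).symm.sum_comp fun p => (u p).val).symm
    have key := card_eq_one_of_weight_eq_five
      (u ![0, 0]) (u ![0, 1]) (u ![0, 2]) (u ![1, 0]) (u ![1, 1]) (u ![1, 2])
      (u ![2, 0]) (u ![2, 1]) (u ![2, 2])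
    rw [hpts]
    have h3 : ∀ f : ZMod 3 → ℕ, ∑ i, f i = f 0 + f 1 + f 2 := Fin.sum_univ_three
    have hp : ∀ p, ∑ x ∈ flatPoints (.inl p), u x = u ![p.1, p.2] := fun p => by
      simp [flatPoints]
    have hl : ∀ p, ∑ x ∈ flatPoints (.inr (.inl p)), u x =
        u ![0, p.2] + u ![1, p.1 + p.2] + u ![2, p.1 * 2 + p.2] := fun p => by
      rw [flatPoints, Finset.sum_insert (by revert p; decide),
          Finset.sum_pair (by revert p; decide), add_assoc]
    have hv : ∀ c, ∑ x ∈ flatPoints (.inr (.inr c)), u x = u ![c, 0] + u ![c, 1] + u ![c, 2] :=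
      fun c => by
        rw [flatPoints, Finset.sum_insert (by revert c; decide),
          Finset.sum_pair (by revert c; decide), add_assoc]
    simp only [Fintype.sum_sum_type, Fintype.sum_prod_type, h3, hp, hl, hv] at h5 ⊢
    have e1 : (1 : ZMod 3) + 1 = 2 := by decide
    have e2 : (1 : ZMod 3) + 2 = 0 := by decide
    have e3 : (2 : ZMod 3) + 1 = 0 := by decide
    have e4 : (2 : ZMod 3) + 2 = 1 := by decide
    have e5 : (2 : ZMod 3) * 2 = 1 := by decide
    simp only [zero_add, zero_mul, one_mul, add_zero, e1, e2, e3, e4, e5] at h5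
    have := key (by linarith)
    linarith
  obtain ⟨p, -, hp⟩ := Finset.exists_ne_zero_of_sum_ne_zero (hsum.trans_ne one_ne_zero)
  have hle : ∑ q ∈ Finset.univ.erase p, (u q).val + (u p).val = 1 := by
    rw [Finset.sum_erase_add _ _ (Finset.mem_univ p), hsum]
  have hp1 : (u p).val = 1 := by omega
  have h0 : ∀ q, q ≠ p → u q = 0 := fun q hq => by
    have := (Finset.sum_eq_zero_iff.1 (show ∑ q ∈ Finset.univ.erase p, (u q).val = 0 by omega)) q
      (Finset.mem_erase.2 ⟨hq, Finset.mem_univ q⟩)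
    exact (ZMod.val_eq_zero _).1 this
  have hu : u p = 1 := (ZMod.val_eq_one one_lt_two _).1 hp1
  refine ⟨p, ?_⟩
  ext s
  rw [flatWord]
  split_ifs with h
  · rw [Finset.sum_eq_single p (fun q _ hq => h0 q hq) (fun h' => absurd h h'), hu]
  · exact Finset.sum_eq_zero fun q hq => h0 q fun h' => h (h' ▸ hq)

theorem mem_codeAut_iff {S : Type*} [Finite S] {C : Submodule (ZMod 2) (S → ZMod 2)}
    {σ : Equiv.Perm S} : σ ∈ codeAut S C ↔ ∀ w ∈ C, w ∘ σ ∈ C := by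
  have hinj : Function.Injective (LinearMap.funLeft (ZMod 2) (ZMod 2) ⇑σ) :=
    LinearMap.funLeft_injective_of_surjective _ _ _ σ.surjective
  change Submodule.map (LinearMap.funLeft (ZMod 2) (ZMod 2) ⇑σ) C = C ↔ _
  constructor
  · intro h w hw
    rw [← h]
    exact ⟨w, hw, rfl⟩
  · intro h
    refine Submodule.eq_of_le_of_finrank_eq ?_
      (Submodule.equivMapOfInjective _ hinj C).finrank_eq.symm
    rintro _ ⟨w, hw, rfl⟩
    exact h w hw

theorem IsFlat.map {s : Finset AffPlane} (hs : IsFlat s) (φ : AffPlane ≃ᵃ[ZMod 3] AffPlane) :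
    IsFlat (s.map φ.toEquiv.toEmbedding) := by
  rcases hs with h | ⟨h, h0⟩
  · exact Or.inl (by rw [Finset.card_map, h])
  · refine Or.inr ⟨by rw [Finset.card_map, h], ?_⟩
    have hφ : ∀ x, φ x = φ.linear x + φ 0 := fun x => by
      simpa using φ.map_vadd 0 x
    have h3 : (3 : ℕ) • φ 0 = 0 := by
      have : ∀ x : AffPlane, (3 : ℕ) • x = 0 := by decide
      exact this _
    rw [Finset.sum_map]
    change ∑ x ∈ s, φ x = 0
    rw [Finset.sum_congr rfl fun x _ => hφ x, Finset.sum_add_distrib, ← map_sum, h0, map_zero,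
      Finset.sum_const, h, h3, add_zero]

/-- The action of the affine group on the points and lines of the affine plane. -/
def flatPerm : (AffPlane ≃ᵃ[ZMod 3] AffPlane) →* Equiv.Perm Flat where
  toFun φ :=
    { toFun := fun s => ⟨s.1.map φ.toEquiv.toEmbedding, s.2.map φ⟩
      invFun := fun s => ⟨s.1.map φ.symm.toEquiv.toEmbedding, s.2.map φ.symm⟩
      left_inv := fun s => Subtype.ext <| by ext; simp
      right_inv := fun s => Subtype.ext <| by ext; simp }
  map_one' := by
    ext s x
    simp [AffineEquiv.one_def]
  map_mul' φ ψ := by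
    ext s x
    simp only [AffineEquiv.mul_def, Equiv.coe_fn_mk, Finset.mem_map_equiv, Equiv.Perm.coe_mul,
      Function.comp_apply]
    rfl

theorem flatPerm_coe (φ : AffPlane ≃ᵃ[ZMod 3] AffPlane) (s : Flat) :
    (flatPerm φ s).1 = s.1.map φ.toEquiv.toEmbedding := rfl

theorem mem_flatPerm {φ : AffPlane ≃ᵃ[ZMod 3] AffPlane} {s : Flat} {p : AffPlane} :
    φ p ∈ (flatPerm φ s).1 ↔ p ∈ s.1 := by
  simp [flatPerm_coe]

theorem flatPerm_injective : Function.Injective flatPerm := by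
  intro φ ψ h
  ext1 p
  have : (flatPerm φ ⟨{p}, Or.inl (Finset.card_singleton p)⟩).1 =
      (flatPerm ψ ⟨{p}, Or.inl (Finset.card_singleton p)⟩).1 := by rw [h]
  simpa [flatPerm_coe] using this

theorem flatPerm_mem_codeAut (φ : AffPlane ≃ᵃ[ZMod 3] AffPlane) :
    flatPerm φ ∈ codeAut Flat flatCode := by
  rw [mem_codeAut_iff]
  intro w hw
  induction hw using Submodule.span_induction with
  | mem w h =>
    obtain ⟨p, rfl⟩ := h
    convert! flatWord_mem (φ.symm p) using 1
    ext s
    have := mem_flatPerm (φ := φ) (s := s) (p := φ.symm p)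
    rw [AffineEquiv.apply_symm_apply] at this
    simp only [Function.comp, flatWord, this]
  | zero => exact zero_mem _
  | add x y _ _ hx hy => exact add_mem hx hy
  | smul a x _ hx => exact Submodule.smul_mem _ a hx

theorem exists_flatPerm_eq {σ : Equiv.Perm Flat} (hσ : σ ∈ codeAut Flat flatCode) :
    ∃ φ, flatPerm φ = σ := by
  have hq : ∀ p, ∃ q, flatWord p ∘ σ = flatWord q := fun p =>
    exists_flatWord_of_weight (mem_codeAut_iff.1 hσ _ (flatWord_mem p))
      (by rw [wordWeight_comp, wordWeight_flatWord])
  choose q hq using hq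
  have hinj : Function.Injective q := fun p p' h =>
    flatWord_injective <| σ.surjective.injective_comp_right <| by
      change flatWord p ∘ σ = flatWord p' ∘ σ
      rw [hq, hq, h]
  let π : AffPlane ≃ AffPlane := (Equiv.ofBijective q (Finite.injective_iff_bijective.1 hinj)).symm
  have hqπ : ∀ p, q (π p) = p := fun p =>
    (Equiv.ofBijective q (Finite.injective_iff_bijective.1 hinj)).apply_symm_apply p
  have hmem : ∀ s p, π p ∈ (σ s).1 ↔ p ∈ s.1 := fun s p => by
    have := congrFun (hq (π p)) s
    rw [hqπ] at this
    simp only [Function.comp, flatWord] at this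
    split_ifs at this <;> simp_all
  have hσ' : ∀ s, (σ s).1 = s.1.map π.toEmbedding := fun s => by
    ext p
    obtain ⟨p, rfl⟩ := π.surjective p
    simp [hmem]
  have hline : ∀ p r, π (-(p + r)) = -(π p + π r) := by
    intro p r
    have h3 : ∀ p : AffPlane, -(p + p) = p := by decide
    rcases eq_or_ne p r with rfl | hpr
    · rw [h3, h3]
    · have h1 : p ≠ -(p + r) := by revert p r; decide
      have h2 : r ≠ -(p + r) := by revert p r; decide
      have hp : p ∉ ({r, -(p + r)} : Finset AffPlane) := by
        simp only [Finset.mem_insert, Finset.mem_singleton, hpr, h1, or_self, not_false_eq_true]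
      have hf : IsFlat {p, r, -(p + r)} := by
        refine Or.inr ⟨Finset.card_eq_three.2 ⟨_, _, _, hpr, h1, h2, rfl⟩, ?_⟩
        rw [Finset.sum_insert hp, Finset.sum_pair h2]
        abel
      have hc : ({p, r, -(p + r)} : Finset AffPlane).card = 3 :=
        Finset.card_eq_three.2 ⟨_, _, _, hpr, h1, h2, rfl⟩
      have := (σ ⟨_, hf⟩).2
      rw [hσ', IsFlat, Finset.card_map, hc, Finset.sum_map,
        Finset.sum_insert hp, Finset.sum_pair h2] at this
      obtain h | ⟨-, h⟩ := this
      · omega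
      · simp only [Equiv.coe_toEmbedding] at h
        linear_combination (exp := 1) h
  have h0 : ∀ p, π (-p) = -(π p + π 0) := fun p => by simpa using hline p 0
  have hadd : ∀ p r, π (p + r) - π 0 = (π p - π 0) + (π r - π 0) := fun p r => by
    have h1 := hline p r
    have h2 := h0 (p + r)
    rw [h1] at h2
    have := neg_injective h2
    linear_combination (exp := 1) -this
  let f : AffPlane →+ AffPlane :=
    { toFun := fun p => π p - π 0
      map_zero' := sub_self _
      map_add' := hadd }
  let φ : AffPlane ≃ᵃ[ZMod 3] AffPlane :=
    { toEquiv := π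
      linear := LinearEquiv.ofBijective (AddMonoidHom.toZModLinearMap 3 f)
        ⟨fun a b h => π.injective (sub_left_injective h),
          fun b => ⟨π.symm (b + π 0), by simp [f]⟩⟩
      map_vadd' := fun p v => by
        have := hadd v p
        change π (v + p) = (π v - π 0) + π p
        linear_combination (exp := 1) this }
  refine ⟨φ, ?_⟩
  ext1 s
  exact Subtype.ext (hσ' s).symm

/-- The automorphism group of `flatCode` is the affine group. -/
noncomputable def codeAutFlatCode :
    codeAut Flat flatCode ≃* (AffPlane ≃ᵃ[ZMod 3] AffPlane) :=
  (MulEquiv.ofBijective (flatPerm.codRestrict _ flatPerm_mem_codeAut)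
    ⟨fun _ _ h => flatPerm_injective (congrArg Subtype.val h),
      fun σ => (exists_flatPerm_eq σ.2).imp fun _ h => Subtype.ext h⟩).symm

theorem card_affineEquiv_affPlane : Nat.card (AffPlane ≃ᵃ[ZMod 3] AffPlane) = 432 := by
  have e : (AffPlane ≃ᵃ[ZMod 3] AffPlane) ≃ AffPlane × (AffPlane ≃ₗ[ZMod 3] AffPlane) :=
    { toFun := fun φ => (φ 0, φ.linear)
      invFun := fun x => x.2.toAffineEquiv.trans (AffineEquiv.constVAdd (ZMod 3) AffPlane x.1)
      left_inv := fun φ => by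
        ext1 x
        have := φ.map_vadd 0 x
        simp only [vadd_eq_add, add_zero] at this
        simp [this, add_comm]
      right_inv := fun x => by
        refine Prod.ext (by simp) ?_
        ext1 y
        change x.2 y = x.2 y
        rfl }
  have e' : GL (Fin 2) (ZMod 3) ≃ (AffPlane ≃ₗ[ZMod 3] AffPlane) :=
    (Matrix.GeneralLinearGroup.toLin.trans
      (LinearMap.GeneralLinearGroup.generalLinearEquiv _ _)).toEquiv
  rw [Nat.card_congr e, Nat.card_prod, ← Nat.card_congr e', Matrix.card_GL_field]
  simp [Fin.prod_univ_two]

/-- Codes that correspond under a bijection of the underlying sets have isomorphic automorphism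
groups. -/
noncomputable def codeAutCongr {S T : Type*} [Finite S] [Finite T] (e : S ≃ T)
    (C : Submodule (ZMod 2) (S → ZMod 2)) (D : Submodule (ZMod 2) (T → ZMod 2))
    (h : ∀ w, w ∘ e ∈ C ↔ w ∈ D) : codeAut S C ≃* codeAut T D :=
  (e.permCongrHom.subgroupMap (codeAut S C)).trans <| MulEquiv.subgroupCongr <| by
    ext σ
    obtain ⟨σ, rfl⟩ := e.permCongrHom.surjective σ
    have : (e.permCongrHom : Equiv.Perm S →* Equiv.Perm T) σ = e.permCongrHom σ := rfl
    rw [← this, Subgroup.mem_map_iff_mem e.permCongrHom.injective, mem_codeAut_iff,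
      mem_codeAut_iff]
    have hw : ∀ w : T → ZMod 2, (w ∘ e.permCongrHom σ) ∘ e = (w ∘ e) ∘ σ := fun w => by
      ext x
      simp [Function.comp]
    constructor
    · intro H w hwD
      rw [this, ← h, hw]
      exact H _ ((h w).2 hwD)
    · intro H w hwC
      have hwe : w = (w ∘ e.symm) ∘ e := by ext x; simp
      rw [hwe, ← hw, h]
      exact H _ ((h _).1 (hwe ▸ hwC))

section LogCoordinates

/-- Vectors with entries in the field with four elements, in logarithmic notation: `none` is the
zero element and `some i` is the `i`-th power of a fixed primitive cube root of unity. -/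
abbrev LogVec : Type := ZMod 3 → Option (ZMod 3)

/-- Which of the nine lines `x (c + 1) = ω ^ i * x c`, labelled by `![c, i]`, contain the point
with the given logarithmic coordinates. -/
def logFlat (v : LogVec) : Finset AffPlane :=
  Finset.univ.filter fun p => v (p 0 + 1) = (v (p 0)).map (p 1 + ·)

/-- A point which lies on the line with label `p` only. -/
def privatePoint (p : AffPlane) : LogVec :=
  Function.update (Function.update (fun _ => none) (p 0) (some 0)) (p 0 + 1) (some (p 1))

/-- The coordinate point that lies on all lines with a label `![1, i]`. -/
def vertexPoint : LogVec := ![some 0, none, none]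

theorem isFlat_logFlat : ∀ v : LogVec, v ≠ (fun _ => none) → IsFlat (logFlat v) := by
  decide +kernel

theorem exists_logFlat_eq :
    ∀ m, ∃ v : LogVec, v ≠ (fun _ => none) ∧ logFlat v = flatPoints m := by
  decide +kernel

theorem logFlat_privatePoint : ∀ p, logFlat (privatePoint p) = {p} := by
  decide +kernel

theorem mem_logFlat_vertexPoint : ∀ p, p ∈ logFlat vertexPoint ↔ p 0 = 1 := by
  decide +kernel

end LogCoordinates

section Coordinates

variable {F : Type*} [Field F]

/-- An element `ω` exhibiting the field as `{0, 1, ω, ω ^ 2}` with `ω ^ 2 = ω + 1`. -/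
structure IsQuaternaryGen (ω : F) : Prop where
  two_eq_zero : (2 : F) = 0
  sq_eq : ω ^ 2 = ω + 1
  eq_or : ∀ x : F, x = 0 ∨ x = 1 ∨ x = ω ∨ x = ω ^ 2

theorem exists_isQuaternaryGen [Fintype F] (hF : Fintype.card F = 4) :
    ∃ ω : F, IsQuaternaryGen ω := by
  have h2 : (2 : F) = 0 := by
    have h4 : ((Fintype.card F : ℕ) : F) = 0 := Nat.cast_card_eq_zero F
    rw [hF] at h4
    have : (2 : F) ^ 2 = 0 := by rw [← h4]; norm_num
    exact pow_eq_zero_iff two_ne_zero |>.1 this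
  have hpow : ∀ x : F, x ^ 4 = x := fun x => by rw [← hF, FiniteField.pow_card]
  classical
  obtain ⟨ω, hω⟩ : ∃ ω : F, ω ∉ ({0, 1} : Finset F) := by
    by_contra! h
    have := Finset.card_le_card (fun x _ => h x : Finset.univ ⊆ ({0, 1} : Finset F))
    rw [Finset.card_univ, hF] at this
    exact absurd (this.trans Finset.card_le_two) (by norm_num)
  simp only [Finset.mem_insert, Finset.mem_singleton, not_or] at hω
  have hsq : ω ^ 2 = ω + 1 := by
    have h0 : ω * (ω - 1) ≠ 0 := mul_ne_zero hω.1 (sub_ne_zero.2 hω.2)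
    refine mul_left_cancel₀ h0 ?_
    linear_combination hpow ω - (ω ^ 3 - ω) * h2
  refine ⟨ω, h2, hsq, fun x => ?_⟩
  have : x * ((x - 1) * ((x - ω) * (x - ω ^ 2))) = 0 := by
    rw [hsq]
    linear_combination hpow x + (x ^ 2 - x) * hsq +
      (- x ^ 3 * ω - x ^ 3 + 2 * x ^ 2 * ω + x ^ 2 - x * ω) * h2
  simpa [sub_eq_zero] using this

namespace IsQuaternaryGen

variable {ω : F}

theorem cube_eq (hω : IsQuaternaryGen ω) : ω ^ 3 = 1 := by
  linear_combination (ω + 1) * hω.sq_eq + ω * hω.two_eq_zero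

theorem ne_zero (hω : IsQuaternaryGen ω) : ω ≠ 0 := by
  intro h
  have := hω.cube_eq
  simp [h] at this

theorem ne_one (hω : IsQuaternaryGen ω) : ω ≠ 1 := by
  intro h
  have := hω.sq_eq
  simp [h] at this

theorem pow_three_eq_one (hω : IsQuaternaryGen ω) {x : F} (hx : x ≠ 0) : x ^ 3 = 1 := by
  rcases hω.eq_or x with rfl | rfl | rfl | rfl
  · exact absurd rfl hx
  · exact one_pow 3
  · exact hω.cube_eq
  · rw [← pow_mul, mul_comm, pow_mul, hω.cube_eq, one_pow]

theorem val_add (hω : IsQuaternaryGen ω) (a b : ZMod 2) :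
    ((a + b).val : F) = a.val + b.val := by
  have h11 : (1 : F) + 1 = 0 := by linear_combination hω.two_eq_zero
  have h : ∀ a b : ZMod 2, a.val + b.val = (a + b).val ∨
      a.val = 1 ∧ b.val = 1 ∧ (a + b).val = 0 := by
    decide
  rcases h a b with h | ⟨ha, hb, hab⟩
  · rw [← h, Nat.cast_add]
  · rw [ha, hb, hab, Nat.cast_one, h11, Nat.cast_zero]

end IsQuaternaryGen

/-- The value in the field of an element in logarithmic notation. -/
def logEval (ω : F) : Option (ZMod 3) → F
  | none => 0
  | some i => ω ^ i.val

@[simp] theorem logEval_none (ω : F) : logEval ω none = 0 := rfl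

@[simp] theorem logEval_some (ω : F) (i : ZMod 3) : logEval ω (some i) = ω ^ i.val := rfl

theorem logEval_injective {ω : F} (hω : IsQuaternaryGen ω) : Function.Injective (logEval ω) := by
  have h0 := hω.ne_zero
  have h1 := hω.ne_one
  have h2 : ω ^ 2 ≠ 1 := by
    rw [hω.sq_eq]
    simpa using h0
  have h3 : ω ^ 2 ≠ ω := by
    rw [hω.sq_eq]
    simp
  have hp : ∀ n : ℕ, ω ^ n ≠ 0 := fun n => pow_ne_zero n h0
  rintro (_ | i) (_ | j) h
  · rfl
  · exact absurd h.symm (hp _)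
  · exact absurd h (hp _)
  · congr 1
    simp only [logEval_some] at h
    fin_cases i <;> fin_cases j <;> first | rfl | simp_all [ZMod.val, eq_comm]

theorem logEval_surjective {ω : F} (hω : IsQuaternaryGen ω) :
    Function.Surjective (logEval ω) := by
  intro x
  rcases hω.eq_or x with h | h | h | h <;> subst x
  · exact ⟨none, rfl⟩
  · exact ⟨some 0, pow_zero ω⟩
  · exact ⟨some 1, pow_one ω⟩
  · exact ⟨some 2, rfl⟩

theorem logEval_map {ω : F} (hω : IsQuaternaryGen ω) (i : ZMod 3) (o : Option (ZMod 3)) :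
    logEval ω (o.map (i + ·)) = ω ^ i.val * logEval ω o := by
  cases o with
  | none => simp
  | some j =>
    simp only [Option.map_some, logEval_some, ← pow_add, ZMod.val_add]
    exact (pow_eq_pow_mod _ hω.cube_eq).symm

open Classical in
/-- Which of the nine lines `x (c + 1) = ω ^ i * x c`, labelled by `![c, i]`, contain the point
with the given homogeneous coordinates. -/
noncomputable def coordFlat (ω : F) (x : ZMod 3 → F) : Finset AffPlane :=
  Finset.univ.filter fun p => x (p 0 + 1) = ω ^ (p 1).val * x (p 0)

theorem mem_coordFlat {ω : F} {x : ZMod 3 → F} {p : AffPlane} :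
    p ∈ coordFlat ω x ↔ x (p 0 + 1) = ω ^ (p 1).val * x (p 0) := by
  simp [coordFlat]

theorem coordFlat_smul_logEval {ω : F} (hω : IsQuaternaryGen ω) {k : F} (hk : k ≠ 0)
    (v : LogVec) : coordFlat ω (k • (logEval ω ∘ v)) = logFlat v := by
  ext p
  simp only [mem_coordFlat, logFlat, Finset.mem_filter, Finset.mem_univ, true_and, Pi.smul_apply,
    smul_eq_mul, Function.comp_apply]
  rw [mul_left_comm, ← logEval_map hω, mul_right_inj' hk, (logEval_injective hω).eq_iff]

end Coordinates

section Plane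

open Module

variable {F : Type*} [Field F] {ω : F}

/-- The projective plane over a field. -/
abbrev ProjPlane (F : Type*) [Field F] : Type _ := Projectivization F (Fin 3 → F)

/-- The homogeneous coordinates of a point with respect to a basis. -/
noncomputable def coords (b : Basis (ZMod 3) F (Fin 3 → F)) (x : ProjPlane F) : ZMod 3 → F :=
  b.equivFun x.rep

theorem coords_ne_zero (b : Basis (ZMod 3) F (Fin 3 → F)) (x : ProjPlane F) : coords b x ≠ 0 := by
  simpa [coords] using x.rep_nonzero

theorem coords_mk (b : Basis (ZMod 3) F (Fin 3 → F)) {v : Fin 3 → F} (hv : v ≠ 0) :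
    ∃ k : F, k ≠ 0 ∧ coords b (Projectivization.mk F v hv) = k • b.equivFun v := by
  obtain ⟨a, ha⟩ := Projectivization.exists_smul_eq_mk_rep F v hv
  exact ⟨a, a.ne_zero, by rw [coords, ← ha, Units.smul_def, map_smul]⟩

/-- A function on the projective plane is Hermitian if it is the sum of a constant and a
sesquilinear form in homogeneous coordinates. -/
def IsHermitianWord (b : Basis (ZMod 3) F (Fin 3 → F)) (w : ProjPlane F → ZMod 2) : Prop :=
  ∃ (c : F) (H : ZMod 3 → ZMod 3 → F), ∀ x,
    ((w x).val : F) = c + ∑ i, ∑ j, H i j * coords b x i * coords b x j ^ 2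

theorem isHermitianWord_of_mem_CDK (hω : IsQuaternaryGen ω) (b : Basis (ZMod 3) F (Fin 3 → F))
    {w : ProjPlane F → ZMod 2} (hw : w ∈ CDK F) : IsHermitianWord b w := by
  induction hw using Submodule.span_induction with
  | mem w h =>
    obtain ⟨_, ⟨φ, -, rfl⟩, rfl⟩ := h
    refine ⟨1, fun i j => φ (b i) * φ (b j) ^ 2, fun x => ?_⟩
    have hx : φ x.rep = ∑ i, coords b x i * φ (b i) := by
      conv_lhs => rw [← b.sum_equivFun x.rep]
      simp only [map_sum, map_smul, smul_eq_mul, coords]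
    have h3 : ∀ f : ZMod 3 → F, ∑ i, f i = f 0 + f 1 + f 2 := Fin.sum_univ_three
    have hcube : 1 + ∑ i, ∑ j, φ (b i) * φ (b j) ^ 2 * coords b x i * coords b x j ^ 2 =
        1 + φ x.rep ^ 3 := by
      rw [hx]
      simp only [h3]
      generalize φ (b 0) = p, φ (b 1) = q, φ (b 2) = r
      generalize coords b x 0 = u, coords b x 1 = v, coords b x 2 = w
      linear_combination (-(u * p + v * q + w * r) *
        (u * p * v * q + u * p * w * r + v * q * w * r)) * hω.two_eq_zero
    rw [hcube]
    by_cases h0 : φ x.rep = 0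
    · rw [Set.indicator_of_mem (by exact h0), h0]
      simp [ZMod.val_one]
    · rw [Set.indicator_of_notMem (by exact h0), hω.pow_three_eq_one h0]
      simp only [ZMod.val_zero, Nat.cast_zero]
      linear_combination -hω.two_eq_zero
  | zero => exact ⟨0, 0, fun x => by simp⟩
  | add w w' _ _ h h' =>
    obtain ⟨c, H, h⟩ := h
    obtain ⟨c', H', h'⟩ := h'
    refine ⟨c + c', H + H', fun x => ?_⟩
    rw [Pi.add_apply, hω.val_add, h, h']
    simp only [Pi.add_apply, add_mul, Finset.sum_add_distrib]
    ring
  | smul a w _ h =>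
    obtain ⟨c, H, h⟩ := h
    have : a = 0 ∨ a = 1 := by revert a; decide
    rcases this with rfl | rfl
    · exact ⟨0, 0, fun x => by simp⟩
    · exact ⟨c, H, fun x => by rw [one_smul, h]⟩

theorem IsHermitianWord.eq_zero (hω : IsQuaternaryGen ω) {b : Basis (ZMod 3) F (Fin 3 → F)}
    {w : ProjPlane F → ZMod 2} (hw : IsHermitianWord b w) {d : ProjPlane F}
    {pt : AffPlane → ProjPlane F}
    (hd : ∃ k : F, k ≠ 0 ∧ coords b d = k • (logEval ω ∘ vertexPoint))
    (hpt : ∀ p, ∃ k : F, k ≠ 0 ∧ coords b (pt p) = k • (logEval ω ∘ privatePoint p))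
    (hwd : w d = 0) (hwpt : ∀ p, w (pt p) = 0) : w = 0 := by
  obtain ⟨c, H, h⟩ := hw
  have h3 : ∀ f : ZMod 3 → F, ∑ i, f i = f 0 + f 1 + f 2 := Fin.sum_univ_three
  have hs : ∀ (x : ProjPlane F) (v : LogVec), (∃ k : F, k ≠ 0 ∧ coords b x = k • (logEval ω ∘ v)) →
      w x = 0 → 0 = c + ∑ i, ∑ j, H i j * logEval ω (v i) * logEval ω (v j) ^ 2 := by
    rintro x v ⟨k, hk, hx⟩ hwx
    have hx' := h x
    rw [hwx, ZMod.val_zero, Nat.cast_zero, hx] at hx'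
    rw [hx']
    congr 1
    refine Finset.sum_congr rfl fun i _ => Finset.sum_congr rfl fun j _ => ?_
    simp only [Pi.smul_apply, Function.comp_apply, smul_eq_mul]
    linear_combination (H i j * logEval ω (v i) * logEval ω (v j) ^ 2) * hω.pow_three_eq_one hk
  have hvd := hs d _ hd hwd
  have hv : ∀ i j : ZMod 3, 0 = c + H i i + H (i + 1) (i + 1) +
      H i (i + 1) * (ω ^ j.val) ^ 2 + H (i + 1) i * ω ^ j.val := by
    intro i j
    have hsum : ∀ (i : ZMod 3) (f : ZMod 3 → F), ∑ k, f k = f i + f (i + 1) + f (i + 2) := by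
      intro i f
      rw [← Equiv.sum_comp (Equiv.addLeft i) f, h3]
      simp
    have hpp : ∀ i j : ZMod 3, privatePoint ![i, j] i = some 0 ∧
        privatePoint ![i, j] (i + 1) = some j ∧ privatePoint ![i, j] (i + 2) = none := by
      decide
    have := hs _ _ (hpt ![i, j]) (hwpt _)
    simp only [hsum i, (hpp i j).1, (hpp i j).2.1, (hpp i j).2.2, logEval_some, logEval_none,
      ZMod.val_zero, pow_zero] at this
    linear_combination this +
      H (i + 1) (i + 1) * hω.pow_three_eq_one (pow_ne_zero j.val hω.ne_zero)
  have h2 := hω.two_eq_zero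
  have hq := hω.sq_eq
  have hS : ∀ i, c + H i i + H (i + 1) (i + 1) = 0 := by
    intro i
    have e0 := hv i 0
    have e1 := hv i 1
    have e2 := hv i 2
    simp only [ZMod.val_zero, ZMod.val_one, show (2 : ZMod 3).val = 2 from rfl, pow_zero, pow_one]
      at e0 e1 e2
    linear_combination -e0 - e1 - e2 - (c + H i i + H (i + 1) (i + 1)) * h2 -
      H i (i + 1) * (hq + (ω + 1) * h2 + ω * hω.cube_eq) - H (i + 1) i * (hq + (ω + 1) * h2)
  have hP : ∀ i, H i (i + 1) = 0 := by
    intro i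
    have e0 := hv i 0
    have e1 := hv i 1
    have e2 := hS i
    simp only [ZMod.val_zero, ZMod.val_one, pow_zero, pow_one] at e0 e1
    linear_combination ω * e0 - e1 + (ω - 1) * e2 - H i (i + 1) * hq
  have hQ : ∀ i, H (i + 1) i = 0 := by
    intro i
    have e0 := hv i 0
    simp only [ZMod.val_zero, pow_zero, hP] at e0
    linear_combination - e0 - hS i
  have h00 : c + H 0 0 = 0 := by
    simp only [h3] at hvd
    simpa [vertexPoint] using hvd.symm
  have h11 : H 1 1 = 0 := by
    have h := hS 0
    rw [zero_add] at h
    linear_combination h - h00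
  have h22 : H 2 2 = 0 := by
    have : (2 : ZMod 3) + 1 = 0 := rfl
    have h := hS 2
    rw [this] at h
    linear_combination h - h00
  have hc : c = 0 := by
    have : (1 : ZMod 3) + 1 = 2 := rfl
    have h := hS 1
    rw [this] at h
    linear_combination h - h11 - h22
  have hH : ∀ i j, H i j = 0 := by
    intro i j
    have hij : ∀ i j : ZMod 3, j = i + 1 ∨ i = j + 1 ∨ i = j := by decide
    rcases hij i j with rfl | rfl | rfl
    · exact hP i
    · exact hQ j
    · have hi : ∀ i : ZMod 3, i = 0 ∨ i = 1 ∨ i = 2 := by decide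
      rcases hi i with rfl | rfl | rfl
      · linear_combination h00 - hc
      · exact h11
      · exact h22
  ext x
  have hx := h x
  simp only [hc, hH, zero_mul, Finset.sum_const_zero, add_zero] at hx
  have : ∀ a : ZMod 2, a = 0 ∨ a.val = 1 := by decide
  rcases this (w x) with h | h
  · exact h
  · rw [h, Nat.cast_one] at hx
    exact absurd hx one_ne_zero

/-- The flat of the affine plane formed by the labels of the special lines through a point. -/
noncomputable def pointFlat (ω : F) (b : Basis (ZMod 3) F (Fin 3 → F)) (x : ProjPlane F) :
    Finset AffPlane := coordFlat ω (coords b x)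

theorem isFlat_pointFlat (hω : IsQuaternaryGen ω) (b : Basis (ZMod 3) F (Fin 3 → F))
    (x : ProjPlane F) : IsFlat (pointFlat ω b x) := by
  choose v hv using fun i => logEval_surjective hω (coords b x i)
  have h1 : coords b x = (1 : F) • (logEval ω ∘ v) := by
    rw [one_smul]
    exact (funext hv).symm
  rw [pointFlat, h1, coordFlat_smul_logEval hω one_ne_zero]
  refine isFlat_logFlat v ?_
  rintro rfl
  refine coords_ne_zero b x ?_
  rw [h1]
  ext i
  simp

theorem exists_point (hω : IsQuaternaryGen ω) (b : Basis (ZMod 3) F (Fin 3 → F)) (v : LogVec)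
    (hv : v ≠ fun _ => none) :
    ∃ x : ProjPlane F, ∃ k : F, k ≠ 0 ∧ coords b x = k • (logEval ω ∘ v) := by
  have h0 : b.equivFun.symm (logEval ω ∘ v) ≠ 0 := by
    intro h
    rw [LinearEquiv.map_eq_zero_iff] at h
    refine hv (funext fun i => logEval_injective hω ?_)
    simpa using congrFun h i
  obtain ⟨k, hk, h⟩ := coords_mk b h0
  exact ⟨_, k, hk, by rw [h, LinearEquiv.apply_symm_apply]⟩

theorem pointFlat_eq (hω : IsQuaternaryGen ω) {b : Basis (ZMod 3) F (Fin 3 → F)} {x : ProjPlane F}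
    {v : LogVec} (h : ∃ k : F, k ≠ 0 ∧ coords b x = k • (logEval ω ∘ v)) :
    pointFlat ω b x = logFlat v := by
  obtain ⟨k, hk, h⟩ := h
  rw [pointFlat, h, coordFlat_smul_logEval hω hk]

theorem pointFlat_bijective [Fintype F] (hF : Fintype.card F = 4) (hω : IsQuaternaryGen ω)
    (b : Basis (ZMod 3) F (Fin 3 → F)) :
    Function.Bijective fun x => (⟨pointFlat ω b x, isFlat_pointFlat hω b x⟩ : Flat) := by
  have hcard : Nat.card (ProjPlane F) = Nat.card Flat := by
    rw [card_flat, Projectivization.card_of_finrank F (Fin 3 → F) (n := 3) (by simp)]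
    simp [Nat.card_eq_fintype_card, hF, Finset.sum_range_succ]
  refine Function.Surjective.bijective_of_nat_card_le ?_ hcard.le
  rintro ⟨s, hs⟩
  obtain ⟨m, rfl⟩ := exists_flatPoints_eq hs
  obtain ⟨v, hv, hm⟩ := exists_logFlat_eq m
  obtain ⟨x, hx⟩ := exists_point hω b v hv
  exact ⟨x, Subtype.ext ((pointFlat_eq hω hx).trans hm)⟩

/-- The indicator function of the special line with a given label. -/
noncomputable def specialLine (ω : F) (b : Basis (ZMod 3) F (Fin 3 → F)) (p : AffPlane) :
    ProjPlane F → ZMod 2 := fun x => if p ∈ pointFlat ω b x then 1 else 0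

theorem specialLine_mem_CDK (b : Basis (ZMod 3) F (Fin 3 → F)) (p : AffPlane) :
    specialLine ω b p ∈ CDK F := by
  classical
  refine Submodule.subset_span ⟨_, ⟨b.coord (p 0 + 1) - ω ^ (p 1).val • b.coord (p 0), ?_, rfl⟩, ?_⟩
  · intro h
    have := LinearMap.congr_fun h (b (p 0 + 1))
    simp at this
  · ext x
    simp [specialLine, pointFlat, mem_coordFlat, coords, Set.indicator_apply, sub_eq_zero]

variable {b : Basis (ZMod 3) F (Fin 3 → F)} {Fs : Finset (Projectivization F (Fin 3 → F))}
  {d : Projectivization F (Fin 3 → F)} {pt : AffPlane → Projectivization F (Fin 3 → F)}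

theorem CF_eq_span (hω : IsQuaternaryGen ω)
    (hd : ∃ k : F, k ≠ 0 ∧ coords b d = k • (logEval ω ∘ vertexPoint))
    (hpt : ∀ p, ∃ k : F, k ≠ 0 ∧ coords b (pt p) = k • (logEval ω ∘ privatePoint p))
    (hFs : ∀ f : ProjPlane F → ZMod 2, ∑ x ∈ Fs, f x = f d + ∑ j, f (pt ![1, j])) :
    CF F Fs = Submodule.span (ZMod 2) (Set.range (specialLine ω b)) := by
  have hmem : ∀ w, w ∈ CF F Fs ↔ w ∈ CDK F ∧ w d + ∑ j, w (pt ![1, j]) = 0 := fun w => by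
    rw [← hFs, CF, Submodule.mem_inf, LinearMap.mem_ker, LinearMap.sum_apply]
    rfl
  have hline : ∀ p q, specialLine ω b p (pt q) = if p = q then 1 else 0 := fun p q => by
    simp [specialLine, pointFlat_eq hω (hpt q), logFlat_privatePoint]
  have hlined : ∀ p, specialLine ω b p d = if p 0 = 1 then 1 else 0 := fun p => by
    simp [specialLine, pointFlat_eq hω hd, mem_logFlat_vertexPoint]
  have hlineCF : ∀ p, specialLine ω b p ∈ CF F Fs := fun p => by
    rw [hmem, hlined]
    simp only [hline]
    refine ⟨specialLine_mem_CDK b p, ?_⟩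
    revert p
    decide
  refine le_antisymm (fun w hw => ?_) (Submodule.span_le.2 (Set.range_subset_iff.2 hlineCF))
  have hsum : ∑ p, w (pt p) • specialLine ω b p ∈
      Submodule.span (ZMod 2) (Set.range (specialLine ω b)) :=
    Submodule.sum_mem _ fun p _ => Submodule.smul_mem _ _ (Submodule.subset_span ⟨p, rfl⟩)
  have hsumCF : ∑ p, w (pt p) • specialLine ω b p ∈ CF F Fs :=
    Submodule.sum_mem _ fun p _ => Submodule.smul_mem _ _ (hlineCF p)
  have hsub := (hmem _).1 (sub_mem hw hsumCF)
  have hpt0 : ∀ q, (w - ∑ p, w (pt p) • specialLine ω b p) (pt q) = 0 := fun q => by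
    simp [hline]
  have := (isHermitianWord_of_mem_CDK hω b hsub.1).eq_zero hω hd hpt
    (by simpa only [hpt0, Finset.sum_const_zero, add_zero] using hsub.2) hpt0
  rw [sub_eq_zero.1 this]
  exact hsum

theorem comp_mem_CF_iff [Fintype F] (hF : Fintype.card F = 4) (hω : IsQuaternaryGen ω)
    (hd : ∃ k : F, k ≠ 0 ∧ coords b d = k • (logEval ω ∘ vertexPoint))
    (hpt : ∀ p, ∃ k : F, k ≠ 0 ∧ coords b (pt p) = k • (logEval ω ∘ privatePoint p))
    (hFs : ∀ f : ProjPlane F → ZMod 2, ∑ x ∈ Fs, f x = f d + ∑ j, f (pt ![1, j]))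
    (w : Flat → ZMod 2) :
    w ∘ Equiv.ofBijective _ (pointFlat_bijective hF hω b) ∈ CF F Fs ↔ w ∈ flatCode := by
  set e := Equiv.ofBijective _ (pointFlat_bijective hF hω b)
  have hinj : Function.Injective (LinearMap.funLeft (ZMod 2) (ZMod 2) e) :=
    LinearMap.funLeft_injective_of_surjective _ _ _ e.surjective
  have : CF F Fs = flatCode.map (LinearMap.funLeft (ZMod 2) (ZMod 2) e) := by
    rw [CF_eq_span hω hd hpt hFs, flatCode, Submodule.map_span, ← Set.range_comp]
    rfl
  rw [this]
  exact hinj.mem_set_image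

theorem exists_smul_add_smul_eq_rep {x y z : ProjPlane F} {φ : (Fin 3 → F) →ₗ[F] F} (hφ : φ ≠ 0)
    (hx : φ x.rep = 0) (hy : φ y.rep = 0) (hz : φ z.rep = 0) (hxy : x ≠ y) (hxz : x ≠ z)
    (hyz : y ≠ z) : ∃ α β : F, α ≠ 0 ∧ β ≠ 0 ∧ α • x.rep + β • y.rep = z.rep := by
  have hmk : ∀ {u v : ProjPlane F} {a : F}, a • u.rep = v.rep → v = u := fun {u v a} h => by
    rw [← u.mk_rep, ← v.mk_rep, Projectivization.mk_eq_mk_iff']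
    exact ⟨a, h⟩
  have hli : LinearIndependent F ![x.rep, y.rep] :=
    Projectivization.linearIndependent_pair_iff_ne.2 hxy
  have hspan : z.rep ∈ Submodule.span F (Set.range ![x.rep, y.rep]) := by
    by_contra hz'
    have hli3 : LinearIndependent F (Fin.cons z.rep ![x.rep, y.rep] : Fin 3 → Fin 3 → F) :=
      linearIndependent_finCons.2 ⟨hli, hz'⟩
    refine hφ ((basisOfLinearIndependentOfCardEqFinrank hli3 (by simp)).ext fun i => ?_)
    rw [coe_basisOfLinearIndependentOfCardEqFinrank]
    fin_cases i
    exacts [hz, hx, hy]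
  simp only [Matrix.range_cons, Matrix.range_empty, Set.union_empty, Set.singleton_union] at hspan
  obtain ⟨α, β, h⟩ := Submodule.mem_span_pair.1 hspan
  refine ⟨α, β, ?_, ?_, h⟩
  · rintro rfl
    rw [zero_smul, zero_add] at h
    exact hyz (hmk h).symm
  · rintro rfl
    rw [zero_smul, add_zero] at h
    exact hxz (hmk h).symm

theorem exists_basis_coords (hω : IsQuaternaryGen ω) {d x y z : ProjPlane F}
    {φ : (Fin 3 → F) →ₗ[F] F}
    (hd : φ d.rep ≠ 0) (hx : φ x.rep = 0) (hy : φ y.rep = 0) (hz : φ z.rep = 0) (hxy : x ≠ y)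
    (hxz : x ≠ z) (hyz : y ≠ z) :
    ∃ b : Basis (ZMod 3) F (Fin 3 → F),
      (∃ k : F, k ≠ 0 ∧ coords b d = k • (logEval ω ∘ vertexPoint)) ∧
      ∀ j, ∃ k : F, k ≠ 0 ∧
        coords b ((![y, z, x] : ZMod 3 → ProjPlane F) j) =
          k • (logEval ω ∘ privatePoint ![1, j]) := by
  have hφ : φ ≠ 0 := by
    rintro rfl
    exact hd rfl
  obtain ⟨α, β, hα, hβ, h⟩ := exists_smul_add_smul_eq_rep hφ hx hy hz hxy hxz hyz
  have h2 := hω.two_eq_zero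
  have hq := hω.sq_eq
  set e := α • x.rep + (ω * β) • y.rep with he
  set f := α • x.rep + (ω ^ 2 * β) • y.rep with hf
  have hli : LinearIndependent F (![d.rep, e, f] : ZMod 3 → Fin 3 → F) := by
    have hxyli : LinearIndependent F ![x.rep, y.rep] :=
      Projectivization.linearIndependent_pair_iff_ne.2 hxy
    rw [LinearIndependent.pair_iff] at hxyli
    rw [Fintype.linearIndependent_iff]
    intro g hg
    have hsum : ∑ i, g i • (![d.rep, e, f] : ZMod 3 → Fin 3 → F) i =
        g 0 • d.rep + g 1 • e + g 2 • f :=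
      Fin.sum_univ_three fun i : Fin 3 => g i • (![d.rep, e, f] : Fin 3 → Fin 3 → F) i
    rw [hsum] at hg
    have hg0 : g 0 = 0 := by
      have := congrArg φ hg
      simp only [he, hf, map_add, map_smul, hx, hy, smul_zero, add_zero, map_zero] at this
      exact (smul_eq_zero.1 this).resolve_right hd
    obtain ⟨h1, h3⟩ := hxyli ((g 1 + g 2) * α) ((g 1 * ω + g 2 * ω ^ 2) * β) (by
      rw [← hg, hg0, he, hf]
      module)
    have h1 := (mul_eq_zero.1 h1).resolve_right hα
    have h3 := (mul_eq_zero.1 h3).resolve_right hβ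
    have hg2 : g 2 = 0 := by linear_combination h3 - ω * h1 - g 2 * hq
    have hi : ∀ i : ZMod 3, i = 0 ∨ i = 1 ∨ i = 2 := by decide
    intro i
    rcases hi i with rfl | rfl | rfl
    exacts [hg0, by linear_combination h1 - hg2, hg2]
  obtain ⟨b, hb⟩ : ∃ b : Basis (ZMod 3) F (Fin 3 → F), ⇑b = ![d.rep, e, f] :=
    ⟨basisOfLinearIndependentOfCardEqFinrank hli (by simp),
      coe_basisOfLinearIndependentOfCardEqFinrank _ _⟩
  have hb0 : b 0 = d.rep := congrFun hb 0
  have hb1 : b 1 = e := congrFun hb 1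
  have hb2 : b 2 = f := congrFun hb 2
  have hcoord : ∀ j : ZMod 3,
      b.equivFun (b 1 + ω ^ j.val • b 2) = logEval ω ∘ privatePoint ![1, j] := by
    intro j
    have hpp : ∀ j : ZMod 3, privatePoint ![1, j] 0 = none ∧
        privatePoint ![1, j] 1 = some 0 ∧ privatePoint ![1, j] 2 = some j := by
      decide
    have hi : ∀ i : ZMod 3, i = 0 ∨ i = 1 ∨ i = 2 := by decide
    have h20 : (2 : ZMod 3) ≠ 0 := by decide
    have h12 : (1 : ZMod 3) ≠ 2 := by decide
    ext i
    rw [map_add, map_smul]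
    rcases hi i with rfl | rfl | rfl
    · simp [hpp, h20]
    · simp [hpp, h12.symm]
    · simp [hpp, h12]
  have hscale : ∀ (u : ProjPlane F) (j : ZMod 3) (k : F), k ≠ 0 →
      u.rep = k • (b 1 + ω ^ j.val • b 2) →
      ∃ k : F, k ≠ 0 ∧ coords b u = k • (logEval ω ∘ privatePoint ![1, j]) :=
    fun u j k hk hu => ⟨k, hk, by rw [coords, hu, map_smul, hcoord]⟩
  have hω0 := hω.ne_zero
  refine ⟨b, ⟨1, one_ne_zero, ?_⟩, fun j => ?_⟩
  · rw [coords, ← hb0, one_smul]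
    have hi : ∀ i : ZMod 3, i = 0 ∨ i = 1 ∨ i = 2 := by decide
    have hvp : vertexPoint 0 = some 0 ∧ vertexPoint 1 = none ∧ vertexPoint 2 = none := by decide
    have h01 : (0 : ZMod 3) ≠ 1 := by decide
    have h02 : (0 : ZMod 3) ≠ 2 := by decide
    ext i
    rcases hi i with rfl | rfl | rfl
    · simp [hvp]
    · simp [hvp, h01]
    · simp [hvp, h02]
  · have hj : ∀ j : ZMod 3, j = 0 ∨ j = 1 ∨ j = 2 := by decide
    have hv2 : (2 : ZMod 3).val = 2 := rfl
    rcases hj j with rfl | rfl | rfl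
    · refine hscale y 0 β⁻¹ (inv_ne_zero hβ) ?_
      rw [eq_inv_smul_iff₀ hβ, hb1, hb2, he, hf]
      ext i
      simp only [ZMod.val_zero, pow_zero, one_smul, Pi.add_apply, Pi.smul_apply, smul_eq_mul]
      linear_combination (-(β * y.rep i)) * hq - (α * x.rep i + ω * β * y.rep i) * h2
    · refine hscale z 1 ω hω0 ?_
      rw [← h, hb1, hb2, he, hf]
      ext i
      simp only [ZMod.val_one, pow_one, Pi.add_apply, Pi.smul_apply, smul_eq_mul]
      linear_combination (α * x.rep i) * (-hq - ω * h2) +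
        (β * y.rep i) * (-hq - ω * h2 - ω * hω.cube_eq)
    · refine hscale x 2 (α⁻¹ * ω ^ 2) (mul_ne_zero (inv_ne_zero hα) (pow_ne_zero 2 hω0)) ?_
      rw [mul_smul, eq_inv_smul_iff₀ hα, hb1, hb2, he, hf, hv2]
      ext i
      simp only [Pi.add_apply, Pi.smul_apply, smul_eq_mul]
      linear_combination (α * x.rep i) * (-hq - ω * h2 - ω * hω.cube_eq) +
        (β * y.rep i) * (-hω.cube_eq - (ω ^ 3 + 1) * hω.cube_eq - h2)

theorem exists_adapted_basis [Fintype F] (hF : Fintype.card F = 4) (hω : IsQuaternaryGen ω)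
    (hcard : Fs.card = 4)
    (hconf : ∃! T : Finset (Projectivization F (Fin 3 → F)),
      T ⊆ Fs ∧ T.card = 3 ∧ CollinSet F ↑T) :
    ∃ (b : Basis (ZMod 3) F (Fin 3 → F)) (d : ProjPlane F) (pt : AffPlane → ProjPlane F),
      (∃ k : F, k ≠ 0 ∧ coords b d = k • (logEval ω ∘ vertexPoint)) ∧
      (∀ p, ∃ k : F, k ≠ 0 ∧ coords b (pt p) = k • (logEval ω ∘ privatePoint p)) ∧
      ∀ f : ProjPlane F → ZMod 2, ∑ x ∈ Fs, f x = f d + ∑ j, f (pt ![1, j]) := by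
  classical
  obtain ⟨T, ⟨hTF, hT3, L, ⟨φ, hφ, rfl⟩, hTL⟩, huniq⟩ := hconf
  obtain ⟨d, hdT, hFsT⟩ : ∃ d ∉ T, insert d T = Fs :=
    Finset.exists_eq_insert_iff.2 ⟨hTF, by rw [hT3, hcard]⟩
  obtain ⟨x, y, z, hxy, hxz, hyz, rfl⟩ := Finset.card_eq_three.1 hT3
  have hx : φ x.rep = 0 := hTL (by simp)
  have hy : φ y.rep = 0 := hTL (by simp)
  have hz : φ z.rep = 0 := hTL (by simp)
  have hd : φ d.rep ≠ 0 := by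
    intro hd
    have hdx : d ≠ x := fun h => hdT (by simp [h])
    have hdy : d ≠ y := fun h => hdT (by simp [h])
    have := huniq {d, x, y} ⟨by rw [← hFsT]; intro u; simp; tauto,
      Finset.card_eq_three.2 ⟨d, x, y, hdx, hdy, hxy, rfl⟩, _, ⟨φ, hφ, rfl⟩, by
        intro u hu
        simp only [Finset.coe_insert, Finset.coe_singleton, Set.mem_insert_iff,
          Set.mem_singleton_iff] at hu
        rcases hu with rfl | rfl | rfl
        exacts [hd, hx, hy]⟩
    exact hdT (this ▸ Finset.mem_insert_self d _)
  obtain ⟨b, hbd, hb⟩ := exists_basis_coords hω hd hx hy hz hxy hxz hyz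
  have hne : ∀ p, privatePoint p ≠ fun _ => none := by decide
  choose pt hpt using fun p => exists_point hω b (privatePoint p) (hne p)
  have hj : ∀ j, pt ![1, j] = (![y, z, x] : ZMod 3 → ProjPlane F) j := fun j =>
    (pointFlat_bijective hF hω b).injective <| Subtype.ext <|
      (pointFlat_eq hω (hpt _)).trans (pointFlat_eq hω (hb j)).symm
  refine ⟨b, d, pt, hbd, hpt, fun f => ?_⟩
  have h3 : ∀ g : ZMod 3 → ZMod 2, ∑ i, g i = g 0 + g 1 + g 2 := Fin.sum_univ_three
  rw [← hFsT, Finset.sum_insert hdT, Finset.sum_insert (by simp [hxy, hxz]),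
    Finset.sum_pair hyz, h3, hj, hj, hj]
  change f d + (f x + (f y + f z)) = f d + (f y + f z + f x)
  ring

end Plane

/-- for a four-point subset `F ⊆ P²(F₄)` with exactly one collinear triple of
points, the group of permutations of the 21 points of `P²(F₄)` preserving the code `C_F`
has order 432, and it is isomorphic to the group of invertible affine transformations of
the affine plane over `F₃` (the automorphism group of the Hesse configuration). -/
theorem aut_code_B (F : Type*) [Field F] [Fintype F] (hF : Fintype.card F = 4)
    (Fs : Finset (Projectivization F (Fin 3 → F))) (hcard : Fs.card = 4)
    (hconf : ∃! T : Finset (Projectivization F (Fin 3 → F)),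
      T ⊆ Fs ∧ T.card = 3 ∧ CollinSet F ↑T) :
    Nat.card (codeAut (Projectivization F (Fin 3 → F)) (CF F Fs)) = 432 ∧
    Nonempty ((codeAut (Projectivization F (Fin 3 → F)) (CF F Fs)) ≃*
      ((Fin 2 → ZMod 3) ≃ᵃ[ZMod 3] (Fin 2 → ZMod 3))) := by
  obtain ⟨ω, hω⟩ := exists_isQuaternaryGen hF
  obtain ⟨b, d, pt, hd, hpt, hFs⟩ := exists_adapted_basis hF hω hcard hconf
  have e : codeAut (Projectivization F (Fin 3 → F)) (CF F Fs) ≃*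
      ((Fin 2 → ZMod 3) ≃ᵃ[ZMod 3] (Fin 2 → ZMod 3)) :=
    (codeAutCongr _ _ _ (comp_mem_CF_iff hF hω hd hpt hFs)).trans codeAutFlatCode
  exact ⟨(Nat.card_congr e.toEquiv).trans card_affineEquiv_affPlane, ⟨e⟩⟩
end
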